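/- Let n ≥ 3. A map Z : P_o^n → K_o^n is an SL(n) contravariant L_∞ Minkowski valuation if and only if there exist constants c₁, c₂ ≥ 0 such that ZP = c₁·Π̂_∞⁺P +_∞ c₂·Π̂_∞⁻P for every P ∈ P_o^n. -/

import Mathlib

open scoped RealInnerProductSpace BigOperators Pointwise ENNReal
open MeasureTheory Filter Matrix

noncomputable section

/-- `Euc n` is Euclidean space `ℝ^n`. -/
abbrev Euc (n : ℕ) := EuclideanSpace ℝ (Fin n)

/-- A convex body in `ℝ^n` containing the origin: a nonempty compact convex set with `0 ∈ K`. -/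
def IsConvexBody0 {n : ℕ} (K : Set (Euc n)) : Prop :=
  IsCompact K ∧ Convex ℝ K ∧ (0 : Euc n) ∈ K

/-- A convex polytope in `ℝ^n` containing the origin. -/
def IsPolytope0 {n : ℕ} (P : Set (Euc n)) : Prop :=
  (∃ S : Finset (Euc n), P = convexHull ℝ (S : Set (Euc n))) ∧ (0 : Euc n) ∈ P

/-- The support function `h_K(x) = sup { ⟪x, y⟫ : y ∈ K }`. -/
def supp {n : ℕ} (K : Set (Euc n)) (x : Euc n) : ℝ :=
  sSup ((fun y => ⟪x, y⟫) '' K)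

/-- The image of a set under the linear map induced by a matrix. -/
def matAct {n : ℕ} (A : Matrix (Fin n) (Fin n) ℝ) (K : Set (Euc n)) : Set (Euc n) :=
  (Matrix.toEuclideanLin A) '' K

/-- The vector `A x`. -/
def matVec {n : ℕ} (A : Matrix (Fin n) (Fin n) ℝ) (x : Euc n) : Euc n :=
  Matrix.toEuclideanLin A x

/-- The dimension of a set: the dimension of (the direction of) its affine hull. -/
def sdim {n : ℕ} (P : Set (Euc n)) : ℕ :=
  Module.finrank ℝ (affineSpan ℝ P).direction

/-- `Z` is `SL(n)` contravariant on polytopes containing the origin: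
`Z(φ P) = φ⁻ᵀ (Z P)`. -/
def SLContravariant {n : ℕ} (Z : Set (Euc n) → Set (Euc n)) : Prop :=
  ∀ (φ : Matrix.SpecialLinearGroup (Fin n) ℝ) (P : Set (Euc n)), IsPolytope0 P →
    Z (matAct (φ : Matrix (Fin n) (Fin n) ℝ) P)
      = matAct (((φ⁻¹ : Matrix.SpecialLinearGroup (Fin n) ℝ) : Matrix (Fin n) (Fin n) ℝ))ᵀ (Z P)

/-- `Z` is an `L_∞` Minkowski valuation on polytopes containing the origin:
`Z(K ∪ L) +_∞ Z(K ∩ L) = Z K +_∞ Z L`, where `A +_∞ B = convexHull (A ∪ B)`. -/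
def ValuationInf {n : ℕ} (Z : Set (Euc n) → Set (Euc n)) : Prop :=
  ∀ K L : Set (Euc n), IsPolytope0 K → IsPolytope0 L → IsPolytope0 (K ∪ L) →
    IsPolytope0 (K ∩ L) →
    convexHull ℝ (Z (K ∪ L) ∪ Z (K ∩ L)) = convexHull ℝ (Z K ∪ Z L)

/-- The face of `P` with outer normal `u`. -/
def face {n : ℕ} (P : Set (Euc n)) (u : Euc n) : Set (Euc n) :=
  {y ∈ P | ⟪u, y⟫ = supp P u}

/-- The asymmetric `L_∞` projection body
`Π̂_∞⁺ P = [o, u/h_P(u) : u ∈ N(P) \\ N_o(P)]`: the convex hull of the origin and the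
points `u / h_P(u)`, where `u` ranges over the outer unit normals of the facets of `P`
not containing the origin (a facet contains the origin iff `h_P(u) = 0`). -/
def projBodyInfPlus {n : ℕ} (P : Set (Euc n)) : Set (Euc n) :=
  convexHull ℝ (insert 0
    {z : Euc n | ∃ u : Euc n, ‖u‖ = 1 ∧ sdim (face P u) = n - 1 ∧ supp P u ≠ 0 ∧
      z = (supp P u)⁻¹ • u})

section

theorem smul_mem_span_nnreal {V : Type*} [AddCommGroup V] [Module ℝ V] {T : Set V} {a : ℝ}
    (ha : 0 ≤ a) {x : V} (hx : x ∈ Submodule.span NNReal T) : a • x ∈ Submodule.span NNReal T := by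
  have := Submodule.smul_mem _ a.toNNReal hx
  rwa [NNReal.smul_def, Real.coe_toNNReal a ha] at this

open scoped NNReal in
/-- The part of a finitely generated cone in a half-space is finitely generated, by the old
generators in the half-space and positive combinations of pairs on the bounding hyperplane. -/
theorem exists_generators_inter_halfspace {V : Type*} [AddCommGroup V] [Module ℝ V]
    (T : Finset V) (f : V →ₗ[ℝ] ℝ) :
    ∃ T' : Finset V,
      (∀ s ∈ T', (s ∈ T ∧ 0 ≤ f s) ∨
        ∃ a ∈ T, ∃ b ∈ T, 0 < f a ∧ f b < 0 ∧ s = f a • b - f b • a) ∧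
      ∀ x ∈ Submodule.span ℝ≥0 (T : Set V), 0 ≤ f x → x ∈ Submodule.span ℝ≥0 (T' : Set V) := by
  classical
  let T' : Finset V := T.filter (fun s => 0 ≤ f s) ∪
    ((T ×ˢ T).filter (fun p => 0 < f p.1 ∧ f p.2 < 0)).image (fun p => f p.1 • p.2 - f p.2 • p.1)
  refine ⟨T', ?_, ?_⟩
  · intro s hs
    simp only [T', Finset.mem_union, Finset.mem_filter, Finset.mem_image, Finset.mem_product,
      Prod.exists] at hs
    rcases hs with hs | ⟨a, b, ⟨⟨ha, hb⟩, h1, h2⟩, rfl⟩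
    · exact Or.inl hs
    · exact Or.inr ⟨a, ha, b, hb, h1, h2, rfl⟩
  intro x hx hfx
  have hle : Submodule.span ℝ≥0 {s | s ∈ T ∧ 0 ≤ f s} ≤ Submodule.span ℝ≥0 (T' : Set V) := by
    apply Submodule.span_mono
    intro s hs
    simp only [T', Finset.coe_union, Set.mem_union, Finset.mem_coe, Finset.mem_filter]
    exact Or.inl hs
  have hsplit : (T : Set V) = {s | s ∈ T ∧ 0 ≤ f s} ∪ {s | s ∈ T ∧ f s < 0} := by
    ext s
    simp only [Finset.mem_coe, Set.mem_union, Set.mem_ofPred_eq]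
    rcases le_or_gt 0 (f s) with h | h
    · simp [h, not_lt.2 h]
    · simp [h, not_le.2 h]
  rw [hsplit, Submodule.span_union, Submodule.mem_sup] at hx
  obtain ⟨p, hp, q, hq, rfl⟩ := hx
  have hnn : ∀ p ∈ Submodule.span ℝ≥0 {s | s ∈ T ∧ 0 ≤ f s}, 0 ≤ f p := by
    intro p hp
    induction hp using Submodule.span_induction with
    | mem x h => exact h.2
    | zero => simp
    | add x y _ _ h1 h2 => rw [map_add]; exact add_nonneg h1 h2
    | smul a x _ h => rw [NNReal.smul_def, map_smul]; exact mul_nonneg a.2 h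
  have hneg : ∀ q ∈ Submodule.span ℝ≥0 {s | s ∈ T ∧ f s < 0}, q = 0 ∨ f q < 0 := by
    intro q hq
    induction hq using Submodule.span_induction with
    | mem x h => exact Or.inr h.2
    | zero => simp
    | add x y _ _ h1 h2 =>
      rcases h1 with rfl | h1
      · simpa using h2
      · rcases h2 with rfl | h2
        · simpa using Or.inr h1
        · right; rw [map_add]; linarith
    | smul a x _ h =>
      rcases h with rfl | h
      · simp
      · rcases eq_or_ne a 0 with rfl | ha
        · simp
        · right
          rw [NNReal.smul_def, map_smul]
          exact mul_neg_of_pos_of_neg (by exact_mod_cast pos_iff_ne_zero.2 ha) h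
  have hmix : ∀ p ∈ Submodule.span ℝ≥0 {s | s ∈ T ∧ 0 ≤ f s},
      ∀ q ∈ Submodule.span ℝ≥0 {s | s ∈ T ∧ f s < 0},
      f p • q - f q • p ∈ Submodule.span ℝ≥0 (T' : Set V) := by
    intro p hp q hq
    induction hp, hq using Submodule.span_induction₂ with
    | mem_mem a b ha hb =>
      rcases ha.2.lt_or_eq with h | h
      · apply Submodule.subset_span
        simp only [T', Finset.coe_union, Set.mem_union, Finset.mem_coe, Finset.mem_image,
          Finset.mem_filter, Finset.mem_product, Prod.exists]
        exact Or.inr ⟨a, b, ⟨⟨ha.1, hb.1⟩, h, hb.2⟩, rfl⟩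
      · rw [← h, zero_smul, zero_sub, ← neg_smul]
        exact smul_mem_span_nnreal (by linarith [hb.2])
          (hle (Submodule.subset_span ha))
    | zero_left y hy => simp
    | zero_right x hx => simp
    | add_left x y z hx hy hz h1 h2 =>
      have : f (x + y) • z - f z • (x + y) = (f x • z - f z • x) + (f y • z - f z • y) := by
        rw [map_add]; module
      rw [this]; exact add_mem h1 h2
    | add_right x y z hx hy hz h1 h2 =>
      have : f x • (y + z) - f (y + z) • x = (f x • y - f y • x) + (f x • z - f z • x) := by
        rw [map_add]; module
      rw [this]; exact add_mem h1 h2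
    | smul_left r x y hx hy h =>
      have : f (r • x) • y - f y • (r • x) = r • (f x • y - f y • x) := by
        simp only [NNReal.smul_def, map_smul, smul_eq_mul]; module
      rw [this]; exact Submodule.smul_mem _ _ h
    | smul_right r x y hx hy h =>
      have : f x • (r • y) - f (r • y) • x = r • (f x • y - f y • x) := by
        simp only [NNReal.smul_def, map_smul, smul_eq_mul]; module
      rw [this]; exact Submodule.smul_mem _ _ h
  rw [map_add] at hfx
  rcases (hnn p hp).lt_or_eq with h | h
  · have : p + q = (f p)⁻¹ • (f p • q - f q • p) + ((f p + f q) / f p) • p := by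
      rw [smul_sub, smul_smul, smul_smul, inv_mul_cancel₀ h.ne', add_div, div_self h.ne']
      module
    rw [this]
    exact add_mem (smul_mem_span_nnreal (by positivity) (hmix p hp q hq))
      (smul_mem_span_nnreal (by positivity) (hle hp))
  · rcases hneg q hq with rfl | hq
    · simpa using hle hp
    · linarith

open scoped NNReal in
/-- A finitely generated cone is a finite intersection of half-spaces. -/
theorem exists_halfspaces_of_span {V : Type*} [AddCommGroup V] [Module ℝ V]
    [FiniteDimensional ℝ V] (T : Finset V) :
    ∃ F : Finset (V →ₗ[ℝ] ℝ), ∀ x, x ∈ Submodule.span ℝ≥0 (T : Set V) ↔ ∀ f ∈ F, 0 ≤ f x := by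
  classical
  induction T using Finset.induction_on with
  | empty =>
    let b := Module.finBasis ℝ V
    refine ⟨Finset.univ.image (fun i => b.coord i) ∪ Finset.univ.image (fun i => -b.coord i), ?_⟩
    intro x
    simp only [Finset.coe_empty, Submodule.span_empty, Submodule.mem_bot]
    constructor
    · rintro rfl; simp
    · intro h
      apply b.ext_elem
      intro i
      have h1 := h (b.coord i) (by simp)
      have h2 := h (-b.coord i) (by simp)
      simp only [LinearMap.neg_apply, Module.Basis.coord_apply] at h1 h2
      simp; linarith
  | insert v T _ ih =>
    obtain ⟨F, hF⟩ := ih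
    refine ⟨F.filter (fun f => 0 ≤ f v) ∪ ((F ×ˢ F).filter (fun p => 0 < p.1 v ∧ p.2 v < 0)).image
      (fun p => p.1 v • p.2 - p.2 v • p.1), ?_⟩
    intro x
    rw [Finset.coe_insert, Submodule.mem_span_insert]
    constructor
    · rintro ⟨a, z, hz, rfl⟩ f hf
      rw [hF] at hz
      simp only [Finset.mem_union, Finset.mem_filter, Finset.mem_image, Finset.mem_product,
        Prod.exists] at hf
      rcases hf with ⟨hf, h⟩ | ⟨g, k, ⟨⟨hg, hk⟩, h1, h2⟩, rfl⟩
      · rw [map_add, NNReal.smul_def, map_smul]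
        exact add_nonneg (mul_nonneg a.2 h) (hz f hf)
      · have h3 := mul_nonneg h1.le (hz k hk)
        have h4 := mul_nonneg (neg_nonneg.2 h2.le) (hz g hg)
        simp only [NNReal.smul_def, map_add, LinearMap.sub_apply, LinearMap.smul_apply, map_smul,
          smul_eq_mul]
        linarith
    · intro h
      have hpos : ∀ f ∈ F, 0 ≤ f v → 0 ≤ f x := fun f hf hfv =>
        h f (by simp [hf, hfv])
      have hmix : ∀ g ∈ F, ∀ k ∈ F, 0 < g v → k v < 0 → 0 ≤ g v * k x - k v * g x := by
        intro g hg k hk h1 h2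
        have := h (g v • k - k v • g) (by
          simp only [Finset.mem_union, Finset.mem_image, Finset.mem_filter, Finset.mem_product,
            Prod.exists]
          exact Or.inr ⟨g, k, ⟨⟨hg, hk⟩, h1, h2⟩, rfl⟩)
        simpa using this
      obtain ⟨t, ht, htmax⟩ := Finset.exists_max_image
        (insert 0 ((F.filter (fun f => f v < 0)).image (fun f => f x / f v))) id (by simp)
      have ht0 : 0 ≤ t := htmax 0 (by simp)
      refine ⟨t.toNNReal, x - t • v, ?_, by simp [NNReal.smul_def, ht0]⟩
      rw [hF]
      intro f hf
      rw [map_sub, map_smul, smul_eq_mul]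
      rcases lt_trichotomy (f v) 0 with hv | hv | hv
      · have := htmax (f x / f v) (by
          simp only [Finset.mem_insert, Finset.mem_image, Finset.mem_filter]
          exact Or.inr ⟨f, ⟨hf, hv⟩, rfl⟩)
        simp only [id] at this
        rw [div_le_iff_of_neg hv] at this
        linarith
      · rw [hv, mul_zero, sub_zero]; exact hpos f hf hv.ge
      · simp only [Finset.mem_insert, Finset.mem_image, Finset.mem_filter] at ht
        rcases ht with rfl | ⟨k, ⟨hk, hkv⟩, rfl⟩
        · simpa using hpos f hf hv.le
        · have := hmix f hf k hk hv hkv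
          have h5 : f x - k x / k v * f v = (f v * k x - k v * f x) / (-k v) := by
            have := hkv.ne
            field_simp
            ring
          rw [h5]
          exact div_nonneg this (by linarith)

open scoped NNReal in
/-- Dehomogenization: the height-one slice of a cone generated by points of positive height is
the convex hull of the normalized generators. -/
theorem mem_span_iff_mem_convexHull {V : Type*} [AddCommGroup V] [Module ℝ V]
    (T : Set (V × ℝ)) (hT : ∀ p ∈ T, 0 < p.2) (x : V) :
    (x, (1 : ℝ)) ∈ Submodule.span ℝ≥0 T ↔
      x ∈ convexHull ℝ ((fun p : V × ℝ => p.2⁻¹ • p.1) '' T) := by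
  constructor
  · have key : ∀ q ∈ Submodule.span ℝ≥0 T, q = 0 ∨
        (0 < q.2 ∧ q.2⁻¹ • q.1 ∈ convexHull ℝ ((fun p : V × ℝ => p.2⁻¹ • p.1) '' T)) := by
      intro q hq
      induction hq using Submodule.span_induction with
      | mem p hp => exact Or.inr ⟨hT p hp, subset_convexHull _ _ ⟨p, hp, rfl⟩⟩
      | zero => simp
      | add p q _ _ h1 h2 =>
        rcases h1 with rfl | ⟨h1, h1'⟩
        · simpa using h2
        rcases h2 with rfl | ⟨h2, h2'⟩
        · rw [add_zero]; exact Or.inr ⟨h1, h1'⟩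
        refine Or.inr ⟨add_pos h1 h2, ?_⟩
        have hs : 0 < p.2 + q.2 := add_pos h1 h2
        have := convex_convexHull ℝ ((fun p : V × ℝ => p.2⁻¹ • p.1) '' T) h1' h2'
          (div_nonneg h1.le hs.le) (div_nonneg h2.le hs.le) (by field_simp)
        convert this using 1
        rw [smul_smul, smul_smul, Prod.fst_add, Prod.snd_add, smul_add]
        congr 2 <;> field_simp
      | smul a p _ h =>
        rcases h with rfl | ⟨h, h'⟩
        · simp
        rcases eq_or_ne a 0 with rfl | ha
        · simp
        have ha' : 0 < (a : ℝ) := by exact_mod_cast pos_iff_ne_zero.2 ha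
        refine Or.inr ⟨?_, ?_⟩
        · rw [NNReal.smul_def, Prod.smul_snd]; exact mul_pos ha' h
        · convert h' using 1
          rw [NNReal.smul_def, Prod.smul_snd, Prod.smul_fst, smul_smul, smul_eq_mul]
          congr 1; field_simp
    intro h
    rcases key _ h with h | ⟨_, h⟩
    · simp at h
    · simpa using h
  · intro h
    have hc : Convex ℝ {x : V | (x, (1 : ℝ)) ∈ Submodule.span ℝ≥0 T} := by
      intro y hy z hz a b ha hb hab
      rw [Set.mem_ofPred_eq] at hy hz ⊢
      have := add_mem (smul_mem_span_nnreal ha hy)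
        (smul_mem_span_nnreal hb hz)
      simpa [NNReal.smul_def, hab] using this
    refine convexHull_min ?_ hc h
    rintro _ ⟨p, hp, rfl⟩
    rw [Set.mem_ofPred_eq]
    have := smul_mem_span_nnreal (inv_pos.2 (hT p hp)).le
      (Submodule.subset_span (R := ℝ≥0) hp)
    have h2 := (hT p hp).ne'
    convert this using 1
    ext <;> simp [h2]

/-- The part of `P` in the half-space with inner normal `u`. -/
def cut {n : ℕ} (P : Set (Euc n)) (u : Euc n) : Set (Euc n) := {x ∈ P | 0 ≤ ⟪u, x⟫}

theorem mem_span_homogenize {n : ℕ} (S : Finset (Euc n)) [DecidableEq (Euc n × ℝ)] (x : Euc n) :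
    (x, (1 : ℝ)) ∈ Submodule.span NNReal
      ((S.image (fun s => (s, (1 : ℝ))) : Finset (Euc n × ℝ)) : Set (Euc n × ℝ)) ↔
      x ∈ convexHull ℝ (S : Set (Euc n)) := by
  rw [mem_span_iff_mem_convexHull]
  · rw [Finset.coe_image, Set.image_image]; simp
  · simp only [Finset.coe_image, Set.mem_image]
    rintro _ ⟨s, _, rfl⟩; exact one_pos

theorem IsPolytope0.cut {n : ℕ} {P : Set (Euc n)} (hP : IsPolytope0 P) (u : Euc n) :
    IsPolytope0 (cut P u) := by
  classical
  obtain ⟨⟨S, rfl⟩, h0⟩ := hP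
  refine ⟨?_, h0, by simp⟩
  let f : Euc n × ℝ →ₗ[ℝ] ℝ := (innerₗ (Euc n) u).comp (LinearMap.fst ℝ _ _)
  obtain ⟨T', hT', hspan⟩ := exists_generators_inter_halfspace
    (S.image (fun s => (s, (1 : ℝ)))) f
  have hpos : ∀ p ∈ (T' : Set (Euc n × ℝ)), 0 < p.2 := by
    intro p hp
    rcases hT' p hp with ⟨h, _⟩ | ⟨a, ha, b, hb, h1, h2, rfl⟩
    · obtain ⟨s, _, rfl⟩ := Finset.mem_image.1 h; exact one_pos
    · obtain ⟨s, _, rfl⟩ := Finset.mem_image.1 ha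
      obtain ⟨t, _, rfl⟩ := Finset.mem_image.1 hb
      simp only [Prod.snd_sub, Prod.smul_snd, smul_eq_mul, mul_one]; linarith
  have hf : ∀ p ∈ T', 0 ≤ f p := by
    intro p hp
    rcases hT' p hp with ⟨_, h⟩ | ⟨a, ha, b, hb, h1, h2, rfl⟩
    · exact h
    · simp [mul_comm]
  refine ⟨T'.image (fun p => p.2⁻¹ • p.1), ?_⟩
  rw [Finset.coe_image]
  ext x
  constructor
  · rintro ⟨hx, hux⟩
    rw [← mem_span_iff_mem_convexHull _ hpos]
    exact hspan _ ((mem_span_homogenize S x).2 hx) hux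
  · intro hx
    rw [← mem_span_iff_mem_convexHull _ hpos] at hx
    constructor
    · rw [← mem_span_homogenize]
      refine Submodule.span_le.2 ?_ hx
      intro p hp
      rcases hT' p hp with ⟨h, _⟩ | ⟨a, ha, b, hb, h1, h2, rfl⟩
      · exact Submodule.subset_span h
      · rw [sub_eq_add_neg, ← neg_smul]
        exact add_mem (smul_mem_span_nnreal h1.le (Submodule.subset_span hb))
          (smul_mem_span_nnreal (by linarith) (Submodule.subset_span ha))
    · have : ∀ q ∈ Submodule.span NNReal (T' : Set (Euc n × ℝ)), 0 ≤ f q := by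
        intro q hq
        induction hq using Submodule.span_induction with
        | mem x h => exact hf x h
        | zero => simp
        | add x y _ _ h1 h2 => rw [map_add]; exact add_nonneg h1 h2
        | smul a x _ h => rw [NNReal.smul_def, map_smul]; exact mul_nonneg a.2 h
      exact this _ hx

/-- A polytope containing the origin is cut out by finitely many inequalities of the forms
`⟪l, x⟫ ≤ 1` and `0 ≤ ⟪u, x⟫`. -/
theorem IsPolytope0.exists_inequalities {n : ℕ} {P : Set (Euc n)} (hP : IsPolytope0 P) :
    ∃ I J : Finset (Euc n), ∀ x, x ∈ P ↔ (∀ l ∈ I, ⟪l, x⟫ ≤ 1) ∧ ∀ u ∈ J, 0 ≤ ⟪u, x⟫ := by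
  classical
  obtain ⟨⟨S, rfl⟩, h0⟩ := hP
  obtain ⟨F, hF⟩ := exists_halfspaces_of_span (S.image (fun s => (s, (1 : ℝ))))
  let g : (Euc n × ℝ →ₗ[ℝ] ℝ) → Euc n := fun f =>
    (InnerProductSpace.toDual ℝ (Euc n)).symm
      (LinearMap.toContinuousLinearMap (f.comp (LinearMap.inl ℝ _ _)))
  have hg : ∀ f x, f (x, 1) = ⟪g f, x⟫ + f (0, 1) := by
    intro f x
    have : (x, (1 : ℝ)) = (x, 0) + (0, 1) := by simp
    rw [this, map_add]
    simp [g]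
  have hb : ∀ f ∈ F, 0 ≤ f (0, 1) := (hF _).1 ((mem_span_homogenize S 0).2 h0)
  refine ⟨(F.filter (fun f => 0 < f (0, 1))).image (fun f => -(f (0, 1))⁻¹ • g f),
    (F.filter (fun f => f (0, 1) = 0)).image g, fun x => ?_⟩
  rw [← mem_span_homogenize, hF]
  constructor
  · intro h
    constructor
    · intro l hl
      obtain ⟨f, hf, rfl⟩ := Finset.mem_image.1 hl
      obtain ⟨hf, hf0⟩ := Finset.mem_filter.1 hf
      have := h f hf
      rw [hg] at this
      rw [inner_smul_left, conj_trivial, neg_mul, inv_mul_eq_div, ← neg_div, div_le_one hf0]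
      linarith
    · intro l hl
      obtain ⟨f, hf, rfl⟩ := Finset.mem_image.1 hl
      obtain ⟨hf, hf0⟩ := Finset.mem_filter.1 hf
      have := h f hf
      rwa [hg, hf0, add_zero] at this
  · rintro ⟨h1, h2⟩ f hf
    rw [hg]
    rcases (hb f hf).lt_or_eq with h | h
    · have := h1 _ (Finset.mem_image_of_mem _ (Finset.mem_filter.2 ⟨hf, h⟩))
      rw [inner_smul_left, conj_trivial, neg_mul, inv_mul_eq_div, ← neg_div, div_le_one h] at this
      linarith
    · rw [← h, add_zero]
      exact h2 _ (Finset.mem_image_of_mem _ (Finset.mem_filter.2 ⟨hf, h.symm⟩))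

end

section

variable {n : ℕ}

theorem IsPolytope0.isConvexBody0 {P : Set (Euc n)} (hP : IsPolytope0 P) : IsConvexBody0 P := by
  obtain ⟨⟨S, rfl⟩, h0⟩ := hP
  exact ⟨S.finite_toSet.isCompact_convexHull ℝ, convex_convexHull _ _, h0⟩

theorem IsConvexBody0.inner_le_supp {K : Set (Euc n)} (hK : IsConvexBody0 K) (x : Euc n)
    {y : Euc n} (hy : y ∈ K) : ⟪x, y⟫ ≤ supp K x :=
  le_csSup (hK.1.image (f := fun y => ⟪x, y⟫) (by fun_prop)).bddAbove ⟨y, hy, rfl⟩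

theorem IsConvexBody0.supp_le {K : Set (Euc n)} (hK : IsConvexBody0 K) {x : Euc n} {c : ℝ}
    (h : ∀ y ∈ K, ⟪x, y⟫ ≤ c) : supp K x ≤ c := by
  unfold supp
  refine csSup_le ⟨_, 0, hK.2.2, rfl⟩ ?_
  rintro _ ⟨y, hy, rfl⟩
  exact h y hy

theorem IsConvexBody0.exists_inner_eq_supp {K : Set (Euc n)} (hK : IsConvexBody0 K) (x : Euc n) :
    ∃ y ∈ K, ⟪x, y⟫ = supp K x :=
  (hK.1.image (f := fun y => ⟪x, y⟫) (by fun_prop)).sSup_mem ⟨_, 0, hK.2.2, rfl⟩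

theorem IsConvexBody0.supp_nonneg {K : Set (Euc n)} (hK : IsConvexBody0 K) (x : Euc n) :
    0 ≤ supp K x := by
  simpa using hK.inner_le_supp x hK.2.2

theorem supp_convexHull_union {A B : Set (Euc n)} (hA : IsConvexBody0 A)
    (hB : IsConvexBody0 B) (x : Euc n) :
    supp (convexHull ℝ (A ∪ B)) x = max (supp A x) (supp B x) := by
  have hle : ∀ y ∈ convexHull ℝ (A ∪ B), ⟪x, y⟫ ≤ max (supp A x) (supp B x) := by
    intro y hy
    have hc : Convex ℝ {y : Euc n | ⟪x, y⟫ ≤ max (supp A x) (supp B x)} :=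
      convex_halfSpace_le ((innerₗ (Euc n) x).isLinear) _
    refine convexHull_min ?_ hc hy
    rintro z (hz | hz)
    · exact (hA.inner_le_supp x hz).trans (le_max_left _ _)
    · exact (hB.inner_le_supp x hz).trans (le_max_right _ _)
  have hbdd : BddAbove ((fun y => ⟪x, y⟫) '' convexHull ℝ (A ∪ B)) :=
    ⟨_, by rintro _ ⟨y, hy, rfl⟩; exact hle y hy⟩
  apply le_antisymm
  · refine csSup_le (Set.Nonempty.image _ ⟨0, subset_convexHull _ _ (Or.inl hA.2.2)⟩) ?_
    rintro _ ⟨y, hy, rfl⟩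
    exact hle y hy
  · apply max_le
    · exact hA.supp_le fun y hy => le_csSup hbdd ⟨y, subset_convexHull _ _ (Or.inl hy), rfl⟩
    · exact hB.supp_le fun y hy => le_csSup hbdd ⟨y, subset_convexHull _ _ (Or.inr hy), rfl⟩

/-- The points `u / h_P(u)` for the normals `u` of the facets of `P` missing the origin. -/
def facetPolars (P : Set (Euc n)) : Set (Euc n) :=
  {z | supp P z = 1 ∧ sdim (face P z) = n - 1}

theorem supp_smul {P : Set (Euc n)} {c : ℝ} (hc : 0 ≤ c) (x : Euc n) :
    supp P (c • x) = c * supp P x := by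
  unfold supp
  rw [← smul_eq_mul, ← Real.sSup_smul_of_nonneg hc, ← Set.image_smul, Set.image_image]
  simp [inner_smul_left]

theorem face_smul {P : Set (Euc n)} {c : ℝ} (hc : 0 < c) (x : Euc n) :
    face P (c • x) = face P x := by
  ext y
  simp [face, supp_smul hc.le, inner_smul_left, hc.ne']

theorem projBodyInfPlus_eq {P : Set (Euc n)} (hP : IsConvexBody0 P) :
    projBodyInfPlus P = convexHull ℝ (insert 0 (facetPolars P)) := by
  unfold projBodyInfPlus
  congr 2
  ext z
  constructor
  · rintro ⟨u, hu, hd, hs, rfl⟩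
    have hpos : 0 < supp P u := (hP.supp_nonneg u).lt_of_ne' hs
    refine ⟨?_, ?_⟩
    · rw [supp_smul (inv_nonneg.2 hpos.le), inv_mul_cancel₀ hs]
    · rwa [face_smul (inv_pos.2 hpos)]
  · rintro ⟨hs, hd⟩
    have hz : z ≠ 0 := by
      rintro rfl
      have := supp_smul (P := P) (le_refl (0 : ℝ)) 0
      simp [hs] at this
    have hz' : 0 < ‖z‖ := norm_pos_iff.2 hz
    have hs' : supp P (‖z‖⁻¹ • z) = ‖z‖⁻¹ := by
      rw [supp_smul (inv_nonneg.2 hz'.le), hs, mul_one]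
    refine ⟨‖z‖⁻¹ • z, ?_, ?_, ?_, ?_⟩
    · rw [norm_smul, norm_inv, norm_norm, inv_mul_cancel₀ hz'.ne']
    · rwa [face_smul (inv_pos.2 hz')]
    · rw [hs']; exact (inv_pos.2 hz').ne'
    · rw [hs', inv_inv, smul_smul, mul_inv_cancel₀ hz'.ne', one_smul]

theorem sdim_eq_finrank_vectorSpan (A : Set (Euc n)) :
    sdim A = Module.finrank ℝ (vectorSpan ℝ A) := by
  rw [sdim, direction_affineSpan]

theorem sdim_image {f : Euc n →ₗ[ℝ] Euc n} (hf : Function.Injective f) (A : Set (Euc n)) :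
    sdim (f '' A) = sdim A := by
  have := AffineMap.map_vectorSpan (k := ℝ) f.toAffineMap (s := A)
  rw [sdim_eq_finrank_vectorSpan, sdim_eq_finrank_vectorSpan,
    (Submodule.equivMapOfInjective f hf (vectorSpan ℝ A)).finrank_eq]
  rw [LinearMap.toAffineMap_linear] at this
  rw [this]
  rfl

theorem sdim_mono {A B : Set (Euc n)} (h : A ⊆ B) : sdim A ≤ sdim B := by
  rw [sdim_eq_finrank_vectorSpan, sdim_eq_finrank_vectorSpan]
  exact Submodule.finrank_mono (vectorSpan_mono ℝ h)

/-- A convex set covered by two affine subspaces lies in one of them. -/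
theorem subset_or_subset_of_subset_union_affineSubspace {C : Set (Euc n)} (hC : Convex ℝ C)
    (V W : AffineSubspace ℝ (Euc n)) (h : C ⊆ (V : Set (Euc n)) ∪ W) :
    C ⊆ (V : Set (Euc n)) ∨ C ⊆ (W : Set (Euc n)) := by
  by_contra hcon
  rw [not_or, Set.not_subset, Set.not_subset] at hcon
  obtain ⟨⟨p, hp, hpV⟩, q, hq, hqW⟩ := hcon
  have hpW := (h hp).resolve_left hpV
  have hqV := (h hq).resolve_right hqW
  have hm : midpoint ℝ p q ∈ C := hC.midpoint_mem hp hq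
  have e1 : AffineMap.lineMap q (midpoint ℝ p q) (2 : ℝ) = p := by
    rw [midpoint_comm]; simp [AffineMap.lineMap_apply, midpoint_eq_smul_add]; module
  have e2 : AffineMap.lineMap p (midpoint ℝ p q) (2 : ℝ) = q := by
    simp [AffineMap.lineMap_apply, midpoint_eq_smul_add]; module
  rcases h hm with h | h
  · exact hpV (e1 ▸ AffineMap.lineMap_mem 2 hqV h)
  · exact hqW (e2 ▸ AffineMap.lineMap_mem 2 hpW h)

theorem sdim_union {A B : Set (Euc n)} (h : Convex ℝ (A ∪ B)) :
    sdim (A ∪ B) = sdim A ∨ sdim (A ∪ B) = sdim B := by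
  rcases subset_or_subset_of_subset_union_affineSubspace h (affineSpan ℝ A) (affineSpan ℝ B)
    (Set.union_subset_union (subset_affineSpan ℝ A) (subset_affineSpan ℝ B)) with h | h
  · left
    have : affineSpan ℝ (A ∪ B) = affineSpan ℝ A :=
      le_antisymm (affineSpan_le.2 h) (affineSpan_mono ℝ Set.subset_union_left)
    rw [sdim, this, sdim]
  · right
    have : affineSpan ℝ (A ∪ B) = affineSpan ℝ B :=
      le_antisymm (affineSpan_le.2 h) (affineSpan_mono ℝ Set.subset_union_right)
    rw [sdim, this, sdim]

theorem vectorSpan_le_orthogonal {A : Set (Euc n)} {z : Euc n} {c : ℝ}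
    (h : ∀ y ∈ A, ⟪z, y⟫ = c) : vectorSpan ℝ A ≤ (ℝ ∙ z)ᗮ := by
  rw [vectorSpan, Submodule.span_le]
  rintro _ ⟨a, ha, b, hb, rfl⟩
  rw [SetLike.mem_coe, Submodule.mem_orthogonal_singleton_iff_inner_right]
  simp only [vsub_eq_sub]
  rw [inner_sub_right, h a ha, h b hb, sub_self]

theorem sdim_le_of_subset_hyperplane {A : Set (Euc n)} {z : Euc n} {c : ℝ} (hz : z ≠ 0)
    (h : ∀ y ∈ A, ⟪z, y⟫ = c) : sdim A ≤ n - 1 := by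
  rw [sdim_eq_finrank_vectorSpan]
  refine (Submodule.finrank_mono (vectorSpan_le_orthogonal h)).trans ?_
  have := Submodule.finrank_add_finrank_orthogonal (ℝ ∙ z)
  rw [finrank_span_singleton hz, finrank_euclideanSpace_fin] at this
  omega

theorem ne_zero_of_mem_facetPolars {P : Set (Euc n)} {z : Euc n} (h : z ∈ facetPolars P) :
    z ≠ 0 := by
  rintro rfl
  have := supp_smul (P := P) (le_refl (0 : ℝ)) 0
  simp [h.1] at this

theorem mem_facetPolars_of_face_subset {P Q : Set (Euc n)} {z : Euc n} (h : z ∈ facetPolars P)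
    (hQ : supp Q z = 1) (hPQ : face P z ⊆ face Q z) : z ∈ facetPolars Q := by
  refine ⟨hQ, le_antisymm ?_ (h.2 ▸ sdim_mono hPQ)⟩
  exact sdim_le_of_subset_hyperplane (ne_zero_of_mem_facetPolars h) fun y hy => hy.2

theorem convex_face {P : Set (Euc n)} (hP : Convex ℝ P) (z : Euc n) : Convex ℝ (face P z) :=
  hP.inter (convex_hyperplane ((innerₗ (Euc n) z).isLinear) _)

theorem facetPolars_subset_of_union {K L : Set (Euc n)} (hK : IsConvexBody0 K)
    (hL : IsConvexBody0 L) (hU : IsConvexBody0 (K ∪ L)) (hI : IsConvexBody0 (K ∩ L)) :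
    facetPolars K ⊆ facetPolars (K ∪ L) ∪ facetPolars (K ∩ L) := by
  intro z hz
  rcases le_or_gt (supp L z) 1 with h | h
  · left
    have hs : supp (K ∪ L) z = 1 := by
      apply le_antisymm
      · apply hU.supp_le
        rintro y (hy | hy)
        · exact hz.1 ▸ hK.inner_le_supp z hy
        · exact (hL.inner_le_supp z hy).trans h
      · obtain ⟨y, hy, hy'⟩ := hK.exists_inner_eq_supp z
        rw [← hz.1, ← hy']
        exact hU.inner_le_supp z (Or.inl hy)
    refine mem_facetPolars_of_face_subset hz hs ?_
    rintro y ⟨hy, hy'⟩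
    exact ⟨Or.inl hy, by rw [hy', hs, hz.1]⟩
  · right
    obtain ⟨q, hq, hq'⟩ := hL.exists_inner_eq_supp z
    have hsub : face K z ⊆ L := by
      rintro p ⟨hp, hpz⟩
      rw [hz.1] at hpz
      rw [← hL.1.isClosed.closure_eq]
      have htend : Tendsto (fun t : ℝ => AffineMap.lineMap p q t) (nhdsWithin 0 (Set.Ioi 0))
          (nhds p) := by
        have : ContinuousAt (fun t : ℝ => (AffineMap.lineMap p q t : Euc n)) 0 :=
          (AffineMap.lineMap_continuous).continuousAt
        have h2 := this.tendsto
        rw [AffineMap.lineMap_apply_zero] at h2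
        exact h2.mono_left nhdsWithin_le_nhds
      refine mem_closure_of_tendsto htend ?_
      filter_upwards [Ioc_mem_nhdsGT (zero_lt_one' ℝ)] with t ht
      have hm : (AffineMap.lineMap p q t : Euc n) ∈ K ∪ L :=
        hU.2.1.lineMap_mem (Or.inl hp) (Or.inr hq) ⟨ht.1.le, ht.2⟩
      refine hm.resolve_left fun hmK => ?_
      have h1 := hK.inner_le_supp z hmK
      rw [hz.1, AffineMap.lineMap_apply_module, inner_add_right, inner_smul_right,
        inner_smul_right, hpz, hq'] at h1
      nlinarith [ht.1, ht.2, mul_pos ht.1 (sub_pos.2 h)]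
    have hs : supp (K ∩ L) z = 1 := by
      apply le_antisymm
      · exact hI.supp_le fun y hy => hz.1 ▸ hK.inner_le_supp z hy.1
      · obtain ⟨y, hy, hy'⟩ := hK.exists_inner_eq_supp z
        rw [← hz.1, ← hy']
        exact hI.inner_le_supp z ⟨hy, hsub ⟨hy, hy'⟩⟩
    refine mem_facetPolars_of_face_subset hz hs ?_
    intro y hy
    exact ⟨⟨hy.1, hsub hy⟩, by rw [hy.2, hs, hz.1]⟩

theorem mem_facetPolars_of_sdim_level {P Q : Set (Euc n)} (hn : 2 ≤ n) {z : Euc n}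
    (hP : IsConvexBody0 P) (hQ : IsConvexBody0 Q) (hPQ : P ⊆ Q) (hz : supp Q z = 1)
    (h : sdim {y ∈ P | ⟪z, y⟫ = 1} = n - 1) : z ∈ facetPolars P := by
  have hne : ({y ∈ P | ⟪z, y⟫ = 1}).Nonempty := by
    by_contra hne
    rw [Set.not_nonempty_iff_eq_empty] at hne
    rw [hne, sdim_eq_finrank_vectorSpan, vectorSpan_empty, finrank_bot] at h
    omega
  obtain ⟨y, hy, hy'⟩ := hne
  have hs : supp P z = 1 := le_antisymm
    (hP.supp_le fun x hx => hz ▸ hQ.inner_le_supp z (hPQ hx)) (hy' ▸ hP.inner_le_supp z hy)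
  exact ⟨hs, by rw [face, hs, h]⟩

theorem facetPolars_union_subset {K L : Set (Euc n)} (hn : 2 ≤ n) (hK : IsConvexBody0 K)
    (hL : IsConvexBody0 L) (hU : IsConvexBody0 (K ∪ L)) :
    facetPolars (K ∪ L) ⊆ facetPolars K ∪ facetPolars L := by
  intro z hz
  have hf : face (K ∪ L) z = {y ∈ K | ⟪z, y⟫ = 1} ∪ {y ∈ L | ⟪z, y⟫ = 1} := by
    ext y
    simp only [face, hz.1, Set.mem_union, Set.mem_ofPred_eq]
    tauto
  have hd := hz.2
  have hc := convex_face hU.2.1 z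
  rw [hf] at hd hc
  rcases sdim_union hc with h | h
  · exact Or.inl (mem_facetPolars_of_sdim_level hn hK hU Set.subset_union_left hz.1 (h ▸ hd))
  · exact Or.inr (mem_facetPolars_of_sdim_level hn hL hU Set.subset_union_right hz.1 (h ▸ hd))

theorem facetPolars_inter_subset {K L : Set (Euc n)} (hK : IsConvexBody0 K)
    (hL : IsConvexBody0 L) (hU : IsConvexBody0 (K ∪ L)) (hI : IsConvexBody0 (K ∩ L)) :
    facetPolars (K ∩ L) ⊆ facetPolars K ∪ facetPolars L := by
  intro z hz
  obtain ⟨y, hy, hy'⟩ := hI.exists_inner_eq_supp z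
  rw [hz.1] at hy'
  have key : ∀ M : Set (Euc n), IsConvexBody0 M → K ∩ L ⊆ M → supp M z ≤ 1 →
      z ∈ facetPolars M := by
    intro M hM hsub hle
    have hs : supp M z = 1 := le_antisymm hle (hy' ▸ hM.inner_le_supp z (hsub hy))
    refine mem_facetPolars_of_face_subset hz hs ?_
    intro x hx
    exact ⟨hsub hx.1, by rw [hx.2, hs, hz.1]⟩
  rcases le_or_gt (supp K z) 1 with h | h
  · exact Or.inl (key K hK Set.inter_subset_left h)
  rcases le_or_gt (supp L z) 1 with h' | h'
  · exact Or.inr (key L hL Set.inter_subset_right h')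
  exfalso
  obtain ⟨p, hp, hpz⟩ := hK.exists_inner_eq_supp z
  obtain ⟨q, hq, hqz⟩ := hL.exists_inner_eq_supp z
  obtain ⟨m, hm, hmI⟩ := isPreconnected_closed_iff.1 (convex_segment (𝕜 := ℝ) p q).isPreconnected
    K L hK.1.isClosed hL.1.isClosed
    (hU.2.1.segment_subset (Or.inl hp) (Or.inr hq))
    ⟨p, left_mem_segment ℝ p q, hp⟩ ⟨q, right_mem_segment ℝ p q, hq⟩
  have hc : Convex ℝ {x : Euc n | 1 < ⟪z, x⟫} :=
    convex_halfSpace_gt ((innerₗ (Euc n) z).isLinear) _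
  have h1 : 1 < ⟪z, m⟫ := hc.segment_subset (by rw [Set.mem_ofPred_eq, hpz]; exact h)
    (by rw [Set.mem_ofPred_eq, hqz]; exact h') hm
  have := hI.inner_le_supp z hmI
  rw [hz.1] at this
  linarith

theorem facetPolars_union_union_inter {K L : Set (Euc n)} (hn : 2 ≤ n) (hK : IsConvexBody0 K)
    (hL : IsConvexBody0 L) (hU : IsConvexBody0 (K ∪ L)) (hI : IsConvexBody0 (K ∩ L)) :
    facetPolars (K ∪ L) ∪ facetPolars (K ∩ L) = facetPolars K ∪ facetPolars L := by
  apply subset_antisymm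
  · exact Set.union_subset (facetPolars_union_subset hn hK hL hU)
      (facetPolars_inter_subset hK hL hU hI)
  · refine Set.union_subset (facetPolars_subset_of_union hK hL hU hI) ?_
    rw [Set.union_comm K L, Set.inter_comm K L] at *
    exact facetPolars_subset_of_union hL hK hU hI

/-- The union of the dilate of `X` by `c₁` and the dilate of `-X` by `c₂`. -/
def twoSided (c₁ c₂ : ℝ) (X : Set (Euc n)) : Set (Euc n) := c₁ • X ∪ c₂ • (-X)

theorem twoSided_union (c₁ c₂ : ℝ) (X Y : Set (Euc n)) :
    twoSided c₁ c₂ (X ∪ Y) = twoSided c₁ c₂ X ∪ twoSided c₁ c₂ Y := by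
  rw [twoSided, twoSided, twoSided, Set.union_neg, Set.smul_set_union, Set.smul_set_union]
  exact Set.union_union_union_comm _ _ _ _

theorem image_twoSided (c₁ c₂ : ℝ) (g : Euc n →ₗ[ℝ] Euc n) (X : Set (Euc n)) :
    g '' twoSided c₁ c₂ X = twoSided c₁ c₂ (g '' X) := by
  have h : g '' (-X) = -(g '' X) := by
    rw [← Set.image_neg_eq_neg, ← Set.image_neg_eq_neg, Set.image_image, Set.image_image]
    simp only [map_neg]
  rw [twoSided, twoSided, Set.image_union, image_smul_set, image_smul_set, h]

theorem convexHull_twoSided_convexHull (c₁ c₂ : ℝ) (X : Set (Euc n)) :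
    convexHull ℝ (c₁ • convexHull ℝ X ∪ c₂ • (-convexHull ℝ X)) =
      convexHull ℝ (twoSided c₁ c₂ X) := by
  rw [← convexHull_neg, ← convexHull_smul, ← convexHull_smul, convexHull_convexHull_union_left,
    convexHull_convexHull_union_right, twoSided]

theorem convexHull_twoSided_valuation (c₁ c₂ : ℝ) {K L : Set (Euc n)} (hn : 2 ≤ n)
    (hK : IsConvexBody0 K) (hL : IsConvexBody0 L) (hU : IsConvexBody0 (K ∪ L))
    (hI : IsConvexBody0 (K ∩ L)) :
    convexHull ℝ (convexHull ℝ (twoSided c₁ c₂ (insert 0 (facetPolars (K ∪ L)))) ∪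
        convexHull ℝ (twoSided c₁ c₂ (insert 0 (facetPolars (K ∩ L))))) =
      convexHull ℝ (convexHull ℝ (twoSided c₁ c₂ (insert 0 (facetPolars K))) ∪
        convexHull ℝ (twoSided c₁ c₂ (insert 0 (facetPolars L)))) := by
  rw [convexHull_convexHull_union_left, convexHull_convexHull_union_right,
    convexHull_convexHull_union_left, convexHull_convexHull_union_right,
    ← twoSided_union, ← twoSided_union, ← Set.insert_union_distrib, ← Set.insert_union_distrib,
    facetPolars_union_union_inter hn hK hL hU hI]

theorem supp_image_adjoint {f g : Euc n →ₗ[ℝ] Euc n} (hgf : ∀ x, g (f x) = x) (P : Set (Euc n))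
    (z : Euc n) : supp (f '' P) (LinearMap.adjoint g z) = supp P z := by
  rw [supp, supp, Set.image_image]
  simp only [LinearMap.adjoint_inner_left, hgf]

theorem adjoint_mem_facetPolars {f g : Euc n →ₗ[ℝ] Euc n} (hgf : ∀ x, g (f x) = x)
    {P : Set (Euc n)} {z : Euc n} (hz : z ∈ facetPolars P) :
    LinearMap.adjoint g z ∈ facetPolars (f '' P) := by
  refine ⟨by rw [supp_image_adjoint hgf, hz.1], ?_⟩
  have : face (f '' P) (LinearMap.adjoint g z) = f '' face P z := by
    ext y
    rw [face, supp_image_adjoint hgf]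
    constructor
    · rintro ⟨⟨x, hx, rfl⟩, h⟩
      rw [LinearMap.adjoint_inner_left, hgf] at h
      exact ⟨x, ⟨hx, h⟩, rfl⟩
    · rintro ⟨x, ⟨hx, h⟩, rfl⟩
      exact ⟨⟨x, hx, rfl⟩, by rw [LinearMap.adjoint_inner_left, hgf, h]⟩
  rw [this, sdim_image (Function.LeftInverse.injective hgf), hz.2]

theorem facetPolars_image {f g : Euc n →ₗ[ℝ] Euc n} (hgf : ∀ x, g (f x) = x)
    (hfg : ∀ x, f (g x) = x) (P : Set (Euc n)) :
    facetPolars (f '' P) = LinearMap.adjoint g '' facetPolars P := by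
  apply subset_antisymm
  · intro z hz
    refine ⟨LinearMap.adjoint f z, ?_, ?_⟩
    · have := adjoint_mem_facetPolars hfg hz
      rwa [Set.image_image, funext hgf, Set.image_id'] at this
    · rw [← LinearMap.comp_apply, ← LinearMap.adjoint_comp,
        show f ∘ₗ g = LinearMap.id from LinearMap.ext hfg, LinearMap.adjoint_id, LinearMap.id_apply]
  · rintro _ ⟨z, hz, rfl⟩
    exact adjoint_mem_facetPolars hgf hz

theorem IsPolytope0.image {P : Set (Euc n)} (hP : IsPolytope0 P) (f : Euc n →ₗ[ℝ] Euc n) :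
    IsPolytope0 (f '' P) := by
  classical
  obtain ⟨⟨S, rfl⟩, h0⟩ := hP
  exact ⟨⟨S.image f, by rw [LinearMap.image_convexHull, Finset.coe_image]⟩, 0, h0, map_zero f⟩

theorem toEuclideanLin_inv_apply (φ : Matrix.SpecialLinearGroup (Fin n) ℝ) (x : Euc n) :
    Matrix.toEuclideanLin ((φ⁻¹ : Matrix.SpecialLinearGroup (Fin n) ℝ) : Matrix (Fin n) (Fin n) ℝ)
      (Matrix.toEuclideanLin (φ : Matrix (Fin n) (Fin n) ℝ) x) = x := by
  have h : ((φ⁻¹ : Matrix.SpecialLinearGroup (Fin n) ℝ) : Matrix (Fin n) (Fin n) ℝ) *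
      (φ : Matrix (Fin n) (Fin n) ℝ) = 1 := by
    rw [← Matrix.SpecialLinearGroup.coe_mul, inv_mul_cancel, Matrix.SpecialLinearGroup.coe_one]
  rw [Matrix.toLpLin_apply, Matrix.toLpLin_apply, Matrix.mulVec_mulVec, h, Matrix.one_mulVec]

theorem toEuclideanLin_transpose (A : Matrix (Fin n) (Fin n) ℝ) :
    Matrix.toEuclideanLin Aᵀ = LinearMap.adjoint (Matrix.toEuclideanLin A) := by
  rw [← Matrix.toEuclideanLin_conjTranspose_eq_adjoint,
    Matrix.conjTranspose_eq_transpose_of_trivial]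

theorem slContravariant_of_eq_twoSided {Z : Set (Euc n) → Set (Euc n)} {c₁ c₂ : ℝ}
    (h : ∀ P, IsPolytope0 P → Z P = convexHull ℝ (twoSided c₁ c₂ (insert 0 (facetPolars P)))) :
    SLContravariant Z := by
  intro φ P hP
  rw [matAct, matAct, h P hP, h _ (hP.image _), facetPolars_image (toEuclideanLin_inv_apply φ)
    (by simpa using toEuclideanLin_inv_apply φ⁻¹), toEuclideanLin_transpose,
    LinearMap.image_convexHull, image_twoSided, Set.image_insert_eq, map_zero]

theorem SLContravariant.apply_image {Z : Set (Euc n) → Set (Euc n)} (hZ : SLContravariant Z)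
    {f : Euc n →ₗ[ℝ] Euc n} (hf : LinearMap.det f = 1) {P : Set (Euc n)} (hP : IsPolytope0 P) :
    Z (f '' P) = {y | LinearMap.adjoint f y ∈ Z P} := by
  let A := Matrix.toEuclideanLin.symm f
  have hA : Matrix.toEuclideanLin A = f := LinearEquiv.apply_symm_apply _ _
  have hdet : A.det = 1 := by
    rw [← hf, ← hA, Matrix.toEuclideanLin, Matrix.toLpLin_eq_toLin, LinearMap.det_toLin]
  let φ : Matrix.SpecialLinearGroup (Fin n) ℝ := ⟨A, hdet⟩
  have := hZ φ P hP
  rw [matAct, matAct, toEuclideanLin_transpose] at this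
  have e1 := toEuclideanLin_inv_apply φ
  have e2 : ∀ x, Matrix.toEuclideanLin (φ : Matrix (Fin n) (Fin n) ℝ)
      (Matrix.toEuclideanLin
        ((φ⁻¹ : Matrix.SpecialLinearGroup (Fin n) ℝ) : Matrix (Fin n) (Fin n) ℝ) x) = x := by
    simpa using toEuclideanLin_inv_apply φ⁻¹
  have hφ : Matrix.toEuclideanLin (φ : Matrix (Fin n) (Fin n) ℝ) = f := hA
  rw [hφ] at this e1 e2
  rw [this]
  set g := Matrix.toEuclideanLin
    ((φ⁻¹ : Matrix.SpecialLinearGroup (Fin n) ℝ) : Matrix (Fin n) (Fin n) ℝ)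
  have e3 : ∀ x, LinearMap.adjoint f (LinearMap.adjoint g x) = x := fun x => by
    rw [← LinearMap.comp_apply, ← LinearMap.adjoint_comp,
      show g ∘ₗ f = LinearMap.id from LinearMap.ext e1, LinearMap.adjoint_id, LinearMap.id_apply]
  have e4 : ∀ x, LinearMap.adjoint g (LinearMap.adjoint f x) = x := fun x => by
    rw [← LinearMap.comp_apply, ← LinearMap.adjoint_comp,
      show f ∘ₗ g = LinearMap.id from LinearMap.ext e2, LinearMap.adjoint_id, LinearMap.id_apply]
  ext y
  constructor
  · rintro ⟨x, hx, rfl⟩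
    rw [Set.mem_ofPred_eq, e3]; exact hx
  · intro hy
    exact ⟨_, hy, e4 y⟩

end

section

variable {n : ℕ} {Z : Set (Euc n) → Set (Euc n)}

/-- An `SL(n)` contravariant `L_∞` Minkowski valuation with values in the convex bodies. -/
structure IsSLValuation (Z : Set (Euc n) → Set (Euc n)) : Prop where
  body : ∀ P, IsPolytope0 P → IsConvexBody0 (Z P)
  val : ValuationInf Z
  contra : SLContravariant Z

theorem mem_cut {P : Set (Euc n)} {u x : Euc n} : x ∈ cut P u ↔ x ∈ P ∧ 0 ≤ ⟪u, x⟫ := Iff.rfl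

theorem cut_subset (P : Set (Euc n)) (u : Euc n) : cut P u ⊆ P := fun _ h => h.1

theorem cut_union_cut_neg (P : Set (Euc n)) (u : Euc n) : cut P u ∪ cut P (-u) = P := by
  ext x
  simp only [Set.mem_union, mem_cut, inner_neg_left]
  constructor
  · rintro (h | h) <;> exact h.1
  · intro h
    rcases le_total 0 (⟪u, x⟫) with h' | h'
    · exact Or.inl ⟨h, h'⟩
    · exact Or.inr ⟨h, by linarith⟩

theorem cut_inter_cut_neg (P : Set (Euc n)) (u : Euc n) :
    cut P u ∩ cut P (-u) = cut (cut P u) (-u) := by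
  ext x
  simp only [Set.mem_inter_iff, mem_cut]
  tauto

theorem inner_eq_zero_of_mem_cut_cut {P : Set (Euc n)} {u x : Euc n}
    (h : x ∈ cut (cut P u) (-u)) : ⟪u, x⟫ = 0 := by
  have h1 := h.1.2
  have h2 := h.2
  rw [inner_neg_left] at h2
  linarith

namespace IsSLValuation

theorem convexHull_cut (hZ : IsSLValuation Z) {P : Set (Euc n)} (hP : IsPolytope0 P)
    (u : Euc n) :
    convexHull ℝ (Z P ∪ Z (cut (cut P u) (-u))) =
      convexHull ℝ (Z (cut P u) ∪ Z (cut P (-u))) := by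
  have := hZ.val (cut P u) (cut P (-u)) (hP.cut u) (hP.cut _)
    (by rwa [cut_union_cut_neg]) (by rw [cut_inter_cut_neg]; exact (hP.cut u).cut _)
  rwa [cut_union_cut_neg, cut_inter_cut_neg] at this

theorem subset_of_cut_subset (hZ : IsSLValuation Z) {P K : Set (Euc n)} (hP : IsPolytope0 P)
    (hK : Convex ℝ K) (u : Euc n) (h : Z (cut P u) ⊆ K) (h' : Z (cut P (-u)) ⊆ K) : Z P ⊆ K := by
  refine Set.Subset.trans ?_ (convexHull_min (Set.union_subset h h') hK)
  rw [← hZ.convexHull_cut hP u]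
  exact Set.subset_union_left.trans (subset_convexHull ℝ _)

theorem cut_subset_of_inter_eq_zero (hZ : IsSLValuation Z) {P : Set (Euc n)}
    (hP : IsPolytope0 P) (u : Euc n) (h : Z (cut (cut P u) (-u)) = {0}) :
    Z (cut P u) ⊆ Z P := by
  have h0 := hZ.body P hP
  have := hZ.convexHull_cut hP u
  rw [h, Set.union_eq_self_of_subset_right (Set.singleton_subset_iff.2 h0.2.2),
    h0.2.1.convexHull_eq] at this
  rw [this]
  exact Set.subset_union_left.trans (subset_convexHull ℝ _)

theorem supp_eq_max (hZ : IsSLValuation Z) {P : Set (Euc n)}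
    (hP : IsPolytope0 P) (u : Euc n) (h : Z (cut (cut P u) (-u)) = {0}) (x : Euc n) :
    supp (Z P) x = max (supp (Z (cut P u)) x) (supp (Z (cut P (-u))) x) := by
  have h0 := hZ.body P hP
  have := hZ.convexHull_cut hP u
  rw [h, Set.union_eq_self_of_subset_right (Set.singleton_subset_iff.2 h0.2.2),
    h0.2.1.convexHull_eq] at this
  rw [this, supp_convexHull_union (hZ.body _ (hP.cut _)) (hZ.body _ (hP.cut _))]

/-- If `P` lies in the hyperplane orthogonal to `u`, then `Z P` lies on the line of `u`. -/
theorem inner_eq_zero_of_orthogonal (hZ : IsSLValuation Z) {P : Set (Euc n)}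
    (hP : IsPolytope0 P) {u w : Euc n} (hu : u ≠ 0) (hPu : ∀ x ∈ P, ⟪u, x⟫ = 0)
    (hw : ⟪u, w⟫ = 0) {y : Euc n} (hy : y ∈ Z P) : ⟪w, y⟫ = 0 := by
  have key : ∀ t : ℝ, y + (t * ⟪w, y⟫) • u ∈ Z P := by
    intro t
    let f : Euc n →ₗ[ℝ] Euc n := LinearMap.transvection (innerₗ (Euc n) u) (t • w)
    have hf : ∀ x, f x = x + ⟪u, x⟫ • t • w := fun x => rfl
    have hdet : LinearMap.det f = 1 := by
      rw [LinearMap.transvection.det]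
      simp [hw]
    have him : f '' P = P := by
      have : ∀ x ∈ P, f x = x := fun x hx => by rw [hf, hPu x hx, zero_smul, add_zero]
      rw [Set.image_congr this, Set.image_id']
    have h1 := hZ.contra.apply_image hdet hP
    rw [him] at h1
    have h2 : LinearMap.adjoint f y = y + (t * ⟪w, y⟫) • u := by
      refine ext_inner_right ℝ fun x => ?_
      rw [LinearMap.adjoint_inner_left, hf]
      simp only [inner_add_right, inner_add_left, inner_smul_left, inner_smul_right,
        conj_trivial, real_inner_comm]
      ring
    rw [← h2]
    rwa [h1] at hy
  by_contra hne
  obtain ⟨R, hR⟩ := (hZ.body P hP).1.isBounded.exists_norm_le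
  have h3 := (hZ.body P hP).inner_le_supp u (key ((supp (Z P) u + 1 - ⟪u, y⟫) / (⟪w, y⟫ * ⟪u, u⟫)))
  have hu' : ⟪u, u⟫ ≠ 0 := by simpa using hu
  rw [inner_add_right, inner_smul_right] at h3
  field_simp at h3
  linarith

theorem eq_zero_of_orthogonal_pair (hZ : IsSLValuation Z) {P : Set (Euc n)}
    (hP : IsPolytope0 P) {u v : Euc n} (huv : LinearIndependent ℝ ![u, v])
    (hu : ∀ x ∈ P, ⟪u, x⟫ = 0) (hv : ∀ x ∈ P, ⟪v, x⟫ = 0) : Z P = {0} := by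
  have hu0 : u ≠ 0 := huv.ne_zero 0
  have hv0 : v ≠ 0 := huv.ne_zero 1
  have h0 := (hZ.body P hP).2.2
  have key : ∀ {u : Euc n} (hu0 : u ≠ 0) (hu : ∀ x ∈ P, ⟪u, x⟫ = 0) (y) (hy : y ∈ Z P),
      ∃ a : ℝ, y = a • u := by
    intro u hu0 hu y hy
    have hu' : ⟪u, u⟫ ≠ 0 := by simpa using hu0
    refine ⟨⟪u, y⟫ / ⟪u, u⟫, ?_⟩
    have h1 : ⟪u, y - (⟪u, y⟫ / ⟪u, u⟫) • u⟫ = 0 := by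
      rw [inner_sub_right, inner_smul_right]
      field_simp
      ring
    have h2 := hZ.inner_eq_zero_of_orthogonal hP hu0 hu h1 hy
    have h3 : ⟪y - (⟪u, y⟫ / ⟪u, u⟫) • u, y - (⟪u, y⟫ / ⟪u, u⟫) • u⟫ = 0 := by
      rw [inner_sub_right (y - (⟪u, y⟫ / ⟪u, u⟫) • u), h2, inner_smul_right,
        real_inner_comm u (y - _), h1]
      simp
    exact sub_eq_zero.1 (inner_self_eq_zero.1 h3)
  refine Set.eq_singleton_iff_unique_mem.2 ⟨h0, fun y hy => ?_⟩
  obtain ⟨a, ha⟩ := key hu0 hu y hy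
  obtain ⟨b, hb⟩ := key hv0 hv y hy
  have := LinearIndependent.pair_iff.1 huv a (-b) (by rw [← ha, neg_smul, ← hb, add_neg_cancel])
  rw [ha, this.1, zero_smul]

end IsSLValuation

/-- The determinant of a family of vectors. -/
def vdet (w : Fin n → Euc n) : ℝ := (EuclideanSpace.basisFun (Fin n) ℝ).toBasis.det w

/-- The basis underlying a family of vectors with nonzero determinant. -/
def vbasis (w : Fin n → Euc n) (hw : vdet w ≠ 0) : Module.Basis (Fin n) ℝ (Euc n) :=
  have h := ((EuclideanSpace.basisFun (Fin n) ℝ).toBasis.is_basis_iff_det).2 (Ne.isUnit hw)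
  Module.Basis.mk h.1 h.2.ge

theorem vbasis_apply {w : Fin n → Euc n} (hw : vdet w ≠ 0) (i : Fin n) :
    vbasis w hw i = w i := by
  rw [vbasis, Module.Basis.mk_apply]

theorem coe_vbasis {w : Fin n → Euc n} (hw : vdet w ≠ 0) : ⇑(vbasis w hw) = w :=
  funext (vbasis_apply hw)

theorem vdet_ne_zero_of_linearIndependent {w : Fin n → Euc n} (hw : LinearIndependent ℝ w) :
    vdet w ≠ 0 := by
  have h := hw.span_eq_top_of_card_eq_finrank' (by simp)
  exact (((EuclideanSpace.basisFun (Fin n) ℝ).toBasis.is_basis_iff_det).1 ⟨hw, h⟩).ne_zero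

theorem exists_inner_family_eq {w : Fin n → Euc n} (hw : vdet w ≠ 0) (c : Fin n → ℝ) :
    ∃ u : Euc n, ∀ i, ⟪u, w i⟫ = c i := by
  refine ⟨(InnerProductSpace.toDual ℝ (Euc n)).symm
    (LinearMap.toContinuousLinearMap ((vbasis w hw).constr ℝ c)), fun i => ?_⟩
  rw [InnerProductSpace.toDual_symm_apply, LinearMap.coe_toContinuousLinearMap', ← vbasis_apply hw,
    Module.Basis.constr_basis]

theorem eq_of_inner_eq {w : Fin n → Euc n} (hw : vdet w ≠ 0) {x y : Euc n}
    (h : ∀ i, ⟪w i, x⟫ = ⟪w i, y⟫) : x = y :=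
  InnerProductSpace.ext_inner_left_basis (𝕜 := ℝ) (vbasis w hw) fun i => by
    rw [vbasis_apply, h]

theorem exists_linearMap_of_vdet_eq {w w' : Fin n → Euc n} (hw : vdet w ≠ 0)
    (h : vdet w' = vdet w) :
    ∃ f : Euc n →ₗ[ℝ] Euc n, LinearMap.det f = 1 ∧ ∀ i, f (w i) = w' i := by
  have hf : ∀ i, (vbasis w hw).constr ℝ w' (w i) = w' i := fun i => by
    conv_lhs => rw [← vbasis_apply hw]
    rw [Module.Basis.constr_basis]
  refine ⟨(vbasis w hw).constr ℝ w', ?_, hf⟩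
  have h1 := Module.Basis.det_comp (EuclideanSpace.basisFun (Fin n) ℝ).toBasis
    ((vbasis w hw).constr ℝ w') w
  rw [show ⇑((vbasis w hw).constr ℝ w') ∘ w = w' from funext hf] at h1
  change vdet w' = _ * vdet w at h1
  rw [h] at h1
  exact (mul_eq_right₀ hw).1 h1.symm

theorem vdet_update_left (w : Fin n → Euc n) {i j : Fin n} (hij : i ≠ j) (a b : ℝ) :
    vdet (Function.update w j (a • w i + b • w j)) = b * vdet w := by
  rw [vdet, AlternatingMap.map_update_add, AlternatingMap.map_update_smul,
    AlternatingMap.map_update_smul, AlternatingMap.map_update_self _ _ hij.symm,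
    Function.update_eq_self]
  simp [vdet]

theorem vdet_update_smul (w : Fin n → Euc n) (k : Fin n) (a : ℝ) :
    vdet (Function.update w k (a • w k)) = a * vdet w := by
  rw [vdet, AlternatingMap.map_update_smul, Function.update_eq_self]
  rfl

theorem vdet_comp_swap (w : Fin n → Euc n) {i j : Fin n} (hij : i ≠ j) :
    vdet (w ∘ Equiv.swap i j) = -vdet w :=
  AlternatingMap.map_swap _ _ hij

/-- The simplex with vertices the origin and `w i`, `i ∈ S`. -/
def splx (w : Fin n → Euc n) (S : Set (Fin n)) : Set (Euc n) := convexHull ℝ (insert 0 (w '' S))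

theorem isPolytope0_splx (w : Fin n → Euc n) (S : Set (Fin n)) : IsPolytope0 (splx w S) := by
  have : (insert 0 (w '' S)).Finite := (S.toFinite.image w).insert 0
  exact ⟨⟨this.toFinset, by rw [this.coe_toFinset, splx]⟩,
    subset_convexHull ℝ _ (Set.mem_insert _ _)⟩

theorem splx_congr {w w' : Fin n → Euc n} {S : Set (Fin n)} (h : ∀ i ∈ S, w i = w' i) :
    splx w S = splx w' S := by
  rw [splx, splx, Set.image_congr h]

theorem image_splx (f : Euc n →ₗ[ℝ] Euc n) (w : Fin n → Euc n) (S : Set (Fin n)) :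
    f '' splx w S = splx (f ∘ w) S := by
  rw [splx, splx, LinearMap.image_convexHull, Set.image_insert_eq, map_zero, Set.image_comp]

theorem vertex_mem_splx (w : Fin n → Euc n) {S : Set (Fin n)} {i : Fin n} (hi : i ∈ S) :
    w i ∈ splx w S :=
  subset_convexHull ℝ _ (Set.mem_insert_of_mem _ ⟨i, hi, rfl⟩)

theorem splx_subset {w : Fin n → Euc n} {S : Set (Fin n)} {K : Set (Euc n)} (hK : Convex ℝ K)
    (h0 : (0 : Euc n) ∈ K) (h : ∀ i ∈ S, w i ∈ K) : splx w S ⊆ K := by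
  refine convexHull_min (Set.insert_subset h0 ?_) hK
  rintro _ ⟨i, hi, rfl⟩
  exact h i hi

theorem mem_splx_iff {w : Fin n → Euc n} {S : Set (Fin n)} {x : Euc n} :
    x ∈ splx w S ↔ ∃ c : Fin n → ℝ, (∀ i, 0 ≤ c i) ∧ (∀ i ∉ S, c i = 0) ∧ ∑ i, c i ≤ 1 ∧
      ∑ i, c i • w i = x := by
  classical
  constructor
  · intro hx
    refine splx_subset (K := {x | ∃ c : Fin n → ℝ, (∀ i, 0 ≤ c i) ∧ (∀ i ∉ S, c i = 0) ∧
      ∑ i, c i ≤ 1 ∧ ∑ i, c i • w i = x}) ?_ ⟨0, by simp⟩ ?_ hx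
    · rintro _ ⟨c, h1, h2, h3, rfl⟩ _ ⟨d, h1', h2', h3', rfl⟩ a b ha hb hab
      refine ⟨fun i => a * c i + b * d i, fun i => ?_, fun i hi => ?_, ?_, ?_⟩
      · have := h1 i
        have := h1' i
        positivity
      · simp [h2 i hi, h2' i hi]
      · rw [Finset.sum_add_distrib, ← Finset.mul_sum, ← Finset.mul_sum]
        nlinarith
      · simp only [add_smul, mul_smul, Finset.sum_add_distrib, Finset.smul_sum]
    · intro i hi
      refine ⟨Pi.single i 1, fun j => ?_, fun j hj => ?_, ?_, ?_⟩
      · by_cases h : j = i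
        · subst h; simp
        · simp [h]
      · have : j ≠ i := fun h => hj (h ▸ hi)
        simp [this]
      · simp
      · simp [Pi.single_apply, ite_smul]
  · rintro ⟨c, h1, h2, h3, rfl⟩
    have hc : Convex ℝ (splx w S) := convex_convexHull _ _
    have h0 : (0 : Euc n) ∈ splx w S := (isPolytope0_splx w S).2
    have : ∀ i ∈ Finset.univ, (if i ∈ S then w i else 0) ∈ splx w S := by
      intro i _
      split_ifs with h
      · exact vertex_mem_splx w h
      · exact h0
    have hs := hc.sum_mem (t := Finset.univ) (w := fun o : Option (Fin n) =>
        o.elim (1 - ∑ i, c i) c) (z := fun o => o.elim 0 fun i => if i ∈ S then w i else 0)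
      (by
        rintro (_ | i) _
        · exact sub_nonneg.2 h3
        · exact h1 i)
      (by simp [Fintype.sum_option])
      (by
        rintro (_ | i) _
        · exact h0
        · exact this i (Finset.mem_univ i))
    rw [Fintype.sum_option] at hs
    simp only [Option.elim_none, smul_zero, zero_add, Option.elim_some] at hs
    rw [Finset.sum_congr rfl fun i _ => ?_]
    · exact hs
    · split_ifs with h
      · rfl
      · rw [h2 i h, zero_smul, zero_smul]

theorem cut_splx_eq {w : Fin n → Euc n} {S : Set (Fin n)} {i j : Fin n}
    (hij : i ≠ j) (hi : i ∈ S) (hj : j ∈ S) {a b : ℝ} (ha : 0 < a) (hb : 0 < b) (hab : a + b = 1)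
    {u : Euc n} (hui : ⟪u, w i⟫ = b) (huj : ⟪u, w j⟫ = -a)
    (hu : ∀ k, k ≠ i → k ≠ j → ⟪u, w k⟫ = 0) :
    cut (splx w S) u = splx (Function.update w j (a • w i + b • w j)) S := by
  classical
  apply subset_antisymm
  · rintro x ⟨hx, hux⟩
    obtain ⟨c, h1, h2, h3, rfl⟩ := mem_splx_iff.1 hx
    have hsum : ∀ f : Fin n → ℝ,
        ∑ k, f k = f i + f j + ∑ k ∈ (Finset.univ.erase i).erase j, f k := by
      intro f
      rw [← Finset.add_sum_erase _ f (Finset.mem_univ i),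
        ← Finset.add_sum_erase (Finset.univ.erase i) f (a := j) (by simp [hij.symm]), add_assoc]
    have hsum' : ∀ f : Fin n → Euc n,
        ∑ k, f k = f i + f j + ∑ k ∈ (Finset.univ.erase i).erase j, f k := by
      intro f
      rw [← Finset.add_sum_erase _ f (Finset.mem_univ i),
        ← Finset.add_sum_erase (Finset.univ.erase i) f (a := j) (by simp [hij.symm]), add_assoc]
    have hne : ∀ k ∈ (Finset.univ.erase i).erase j, k ≠ i ∧ k ≠ j := fun k hk => by
      simp only [Finset.mem_erase] at hk; exact ⟨hk.2.1, hk.1⟩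
    have hci : a * c j ≤ b * c i := by
      rw [inner_sum, hsum, Finset.sum_eq_zero (s := (Finset.univ.erase i).erase j)
        (fun k hk => by rw [inner_smul_right, hu k (hne k hk).1 (hne k hk).2, mul_zero]),
        inner_smul_right, inner_smul_right, hui, huj] at hux
      linarith
    let d : Fin n → ℝ := Function.update (Function.update c i (c i - a * c j / b)) j (c j / b)
    have hdi : d i = c i - a * c j / b := by simp [d, hij]
    have hdj : d j = c j / b := by simp [d]
    have hdk : ∀ k, k ≠ i → k ≠ j → d k = c k := fun k h h' => by simp [d, h, h']
    refine mem_splx_iff.2 ⟨d, fun k => ?_, fun k hk => ?_, ?_, ?_⟩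
    · by_cases h : k = i
      · rw [h, hdi, sub_nonneg, div_le_iff₀ hb]; linarith
      by_cases h' : k = j
      · rw [h', hdj]; exact div_nonneg (h1 j) hb.le
      rw [hdk k h h']; exact h1 k
    · rw [hdk k (fun h => hk (h ▸ hi)) (fun h => hk (h ▸ hj)), h2 k hk]
    · rw [hsum] at h3 ⊢
      rw [Finset.sum_congr rfl fun k hk => hdk k (hne k hk).1 (hne k hk).2, hdi, hdj]
      have : c i - a * c j / b + c j / b = c i + c j := by
        field_simp
        linear_combination -(c j) * hab
      linarith
    · rw [hsum', hsum' (fun k => c k • w k), Finset.sum_congr rfl fun k hk => by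
        rw [hdk k (hne k hk).1 (hne k hk).2, Function.update_of_ne (hne k hk).2], hdi, hdj,
        Function.update_self, Function.update_of_ne hij]
      congr 1
      rw [smul_add, smul_smul, smul_smul, div_mul_cancel₀ _ hb.ne', sub_smul, ← add_assoc,
        show a * c j / b = c j / b * a by ring]
      abel
  · have hm : a • w i + b • w j ∈ splx w S := by
      exact convex_convexHull ℝ _ (vertex_mem_splx w hi) (vertex_mem_splx w hj) ha.le hb.le hab
    have hcc : Convex ℝ (cut (splx w S) u) :=
      (convex_convexHull ℝ _).inter (convex_halfSpace_ge ((innerₗ (Euc n) u).isLinear) 0)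
    refine splx_subset hcc ⟨(isPolytope0_splx w S).2, by simp⟩ fun k hk => ?_
    by_cases h : k = j
    · subst h
      rw [Function.update_self]
      refine ⟨hm, ?_⟩
      rw [inner_add_right, inner_smul_right, inner_smul_right, hui, huj]
      linarith
    · rw [Function.update_of_ne h]
      refine ⟨vertex_mem_splx w hk, ?_⟩
      by_cases h' : k = i
      · rw [h', hui]; exact hb.le
      · rw [hu k h' h]

theorem exists_cut_splx {w : Fin n → Euc n} (hw : vdet w ≠ 0) {S : Set (Fin n)} {i j : Fin n}
    (hij : i ≠ j) (hi : i ∈ S) (hj : j ∈ S) {a b : ℝ} (ha : 0 < a) (hb : 0 < b)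
    (hab : a + b = 1) :
    ∃ u : Euc n, (∀ k, ⟪u, w k⟫ = if k = i then b else if k = j then -a else 0) ∧
      cut (splx w S) u = splx (Function.update w j (a • w i + b • w j)) S ∧
      cut (splx w S) (-u) = splx (Function.update w i (b • w j + a • w i)) S := by
  obtain ⟨u, hu⟩ := exists_inner_family_eq hw fun k => if k = i then b else if k = j then -a else 0
  refine ⟨u, hu, cut_splx_eq hij hi hj ha hb hab (by simp [hu]) (by simp [hu, hij.symm])
    (fun k h h' => by simp [hu, h, h']), cut_splx_eq hij.symm hj hi hb ha (by linarith)
    (by simp [hu, hij.symm]) (by simp [hu]) (fun k h h' => by simp [hu, h, h'])⟩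

namespace IsSLValuation

theorem supp_image (hZ : IsSLValuation Z) {f : Euc n →ₗ[ℝ] Euc n} (hf : LinearMap.det f = 1)
    {P : Set (Euc n)} (hP : IsPolytope0 P) (x : Euc n) :
    supp (Z (f '' P)) (f x) = supp (Z P) x := by
  let e := LinearEquiv.ofIsUnitDet (f := f) (v := (EuclideanSpace.basisFun (Fin n) ℝ).toBasis)
    (v' := (EuclideanSpace.basisFun (Fin n) ℝ).toBasis) (by
      rw [LinearMap.det_toMatrix, hf]; exact isUnit_one)
  have he : ∀ x, f (e.symm x) = x := fun x => e.apply_symm_apply x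
  have he' : ∀ x, LinearMap.adjoint f (LinearMap.adjoint (e.symm : Euc n →ₗ[ℝ] Euc n) x) = x := by
    intro x
    refine ext_inner_right ℝ fun y => ?_
    rw [LinearMap.adjoint_inner_left, LinearMap.adjoint_inner_left]
    congr 1
    exact e.symm_apply_apply y
  rw [hZ.contra.apply_image hf hP]
  refine le_antisymm ?_ ?_
  · refine csSup_le ⟨_, 0, by simpa using (hZ.body P hP).2.2, rfl⟩ ?_
    rintro _ ⟨y, hy, rfl⟩
    change ⟪f x, y⟫ ≤ _
    rw [← LinearMap.adjoint_inner_right]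
    exact (hZ.body P hP).inner_le_supp x hy
  · have hb := hZ.body _ (hP.image f)
    rw [hZ.contra.apply_image hf hP] at hb
    refine (hZ.body P hP).supp_le fun y hy => ?_
    rw [← he' y, LinearMap.adjoint_inner_right]
    refine hb.inner_le_supp _ ?_
    rw [Set.mem_ofPred_eq, he']
    exact hy

theorem exists_supp_splx (hZ : IsSLValuation Z) {w w' : Fin n → Euc n} (hw : vdet w ≠ 0)
    (h : vdet w' = vdet w) (S : Set (Fin n)) :
    ∃ f : Euc n →ₗ[ℝ] Euc n, (∀ i, f (w i) = w' i) ∧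
      ∀ x, supp (Z (splx w' S)) (f x) = supp (Z (splx w S)) x := by
  obtain ⟨f, hf, hfw⟩ := exists_linearMap_of_vdet_eq hw h
  refine ⟨f, hfw, fun x => ?_⟩
  rw [← hZ.supp_image hf (isPolytope0_splx w S), image_splx,
    show ⇑f ∘ w = w' from funext hfw]

/-- `Z` vanishes on the `(n-1)`-dimensional simplices with a vertex at the origin. -/
theorem splx_compl_eq_zero (hZ : IsSLValuation Z) (hn : 3 ≤ n) {w : Fin n → Euc n}
    (hw : vdet w ≠ 0) (k : Fin n) (hk : ∀ i, i ≠ k → ⟪w k, w i⟫ = 0) :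
    Z (splx w {k}ᶜ) = {0} := by
  classical
  obtain ⟨i, hik⟩ : ∃ i, i ≠ k := by
    have : Nontrivial (Fin n) := Fin.nontrivial_iff_two_le.2 (by omega)
    exact exists_ne k
  obtain ⟨j, hj⟩ : ∃ j, j ∉ ({k, i} : Finset (Fin n)) := by
    by_contra! h
    have h1 : (Finset.univ : Finset (Fin n)).card ≤ ({k, i} : Finset (Fin n)).card :=
      Finset.card_le_card fun x _ => h x
    have h2 := Finset.card_le_two (a := k) (b := i)
    simp at h1
    omega
  simp only [Finset.mem_insert, Finset.mem_singleton, not_or] at hj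
  obtain ⟨hjk, hji⟩ := hj
  have hPk : ∀ x ∈ splx w {k}ᶜ, ⟪w k, x⟫ = 0 := fun x hx =>
    splx_subset (K := {x | ⟪w k, x⟫ = 0}) (convex_hyperplane (innerₗ (Euc n) (w k)).isLinear 0)
      (by simp) (fun i hi => hk i hi) hx
  have hk0 : w k ≠ 0 := fun h => by
    have := (vbasis w hw).ne_zero k
    rw [vbasis_apply] at this
    exact this h
  have hkk : 0 < ⟪w k, w k⟫ := real_inner_self_pos.2 hk0
  obtain ⟨u, hu, hc1, hc2⟩ := exists_cut_splx hw (S := {k}ᶜ) (i := i) (j := j) (Ne.symm hji) hik hjk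
    (a := 1 / 2) (b := 1 / 2) (by norm_num) (by norm_num) (by norm_num)
  have hli : LinearIndependent ℝ ![w k, u] := by
    refine LinearIndependent.pair_iff.2 fun s t hst => ?_
    have h1 := congrArg (fun x => ⟪x, w k⟫) hst
    have h2 := congrArg (fun x => ⟪x, w i⟫) hst
    simp only [inner_add_left, inner_smul_left, hu, inner_zero_left, hk i hik,
      conj_trivial] at h1 h2
    simp only [if_neg hik.symm, if_neg (Ne.symm hjk), if_true] at h1 h2
    refine ⟨?_, by linarith⟩
    have : s * ⟪w k, w k⟫ = 0 := by linarith
    exact (mul_eq_zero.1 this).resolve_right hkk.ne'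
  have hP := isPolytope0_splx w {k}ᶜ
  have hz : Z (cut (cut (splx w {k}ᶜ) u) (-u)) = {0} :=
    hZ.eq_zero_of_orthogonal_pair ((hP.cut u).cut _) hli (fun x hx => hPk x hx.1.1)
      (fun x hx => inner_eq_zero_of_mem_cut_cut hx)
  have hhalf : ∀ (w' : Fin n → Euc n), w' k = w k → vdet w' = 1 / 2 * vdet w → ∀ s : ℝ,
      supp (Z (splx w' {k}ᶜ)) (s • w k) = 1 / 2 * supp (Z (splx w {k}ᶜ)) (s • w k) := by
    intro w' hw'k hd s
    have hd' : vdet (Function.update w' k ((2 : ℝ) • w' k)) = vdet w := by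
      rw [vdet_update_smul, hd]; ring
    obtain ⟨f, hf, hfs⟩ := hZ.exists_supp_splx hw hd' {k}ᶜ
    have h1 := hfs (s • w k)
    rw [map_smul, hf, Function.update_self, hw'k, smul_comm, supp_smul (by norm_num),
      splx_congr (S := {k}ᶜ) (w' := w') (fun i hi => Function.update_of_ne hi _ _)] at h1
    linarith
  have hzero : ∀ s : ℝ, supp (Z (splx w {k}ᶜ)) (s • w k) = 0 := by
    intro s
    have h1 := hZ.supp_eq_max hP u hz (s • w k)
    rw [hc1, hc2, hhalf _ (Function.update_of_ne (Ne.symm hjk) _ _)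
      (vdet_update_left w (Ne.symm hji) _ _), hhalf _ (Function.update_of_ne hik.symm _ _)
      (vdet_update_left w hji _ _), max_self] at h1
    linarith
  refine Set.eq_singleton_iff_unique_mem.2 ⟨(hZ.body _ hP).2.2, fun y hy => ?_⟩
  have h1 := (hZ.body _ hP).inner_le_supp ((1 : ℝ) • w k) hy
  have h2 := (hZ.body _ hP).inner_le_supp ((-1 : ℝ) • w k) hy
  rw [hzero, inner_smul_left] at h1 h2
  simp only [conj_trivial] at h1 h2
  refine eq_of_inner_eq hw fun i => ?_
  rw [inner_zero_right]
  by_cases h : i = k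
  · rw [h]; linarith
  · exact hZ.inner_eq_zero_of_orthogonal hP hk0 hPk (hk i h) hy

end IsSLValuation

end

section

variable {n : ℕ} {Z : Set (Euc n) → Set (Euc n)}

/-- The intersection of `P` with the half-spaces `{x | 0 ≤ ⟪u, x⟫}`, `u ∈ F`. -/
def mcut (P : Set (Euc n)) (F : Finset (Euc n)) : Set (Euc n) := {x ∈ P | ∀ u ∈ F, 0 ≤ ⟪u, x⟫}

theorem mem_mcut {P : Set (Euc n)} {F : Finset (Euc n)} {x : Euc n} :
    x ∈ mcut P F ↔ x ∈ P ∧ ∀ u ∈ F, 0 ≤ ⟪u, x⟫ := Iff.rfl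

theorem mcut_subset (P : Set (Euc n)) (F : Finset (Euc n)) : mcut P F ⊆ P := fun _ h => h.1

theorem mcut_empty (P : Set (Euc n)) : mcut P ∅ = P := by
  ext x
  simp [mem_mcut]

theorem mcut_insert [DecidableEq (Euc n)] (P : Set (Euc n)) (u : Euc n) (F : Finset (Euc n)) :
    mcut P (insert u F) = cut (mcut P F) u := by
  ext x
  simp only [mem_mcut, mem_cut, Finset.forall_mem_insert]
  tauto

theorem IsPolytope0.mcut {P : Set (Euc n)} (hP : IsPolytope0 P) (F : Finset (Euc n)) :
    IsPolytope0 (mcut P F) := by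
  classical
  induction F using Finset.induction_on with
  | empty => rwa [mcut_empty]
  | insert u F _ ih => rw [mcut_insert]; exact ih.cut u

/-- On polytopes contained in `W`, the map `Z` is monotone under cuts by half-spaces. -/
def CutMono (Z : Set (Euc n) → Set (Euc n)) (W : Set (Euc n)) : Prop :=
  ∀ P, IsPolytope0 P → P ⊆ W → ∀ u, Z (cut P u) ⊆ Z P

theorem CutMono.mcut_subset {W : Set (Euc n)} (h : CutMono Z W) {P : Set (Euc n)}
    (hP : IsPolytope0 P) (hW : P ⊆ W) (F : Finset (Euc n)) : Z (mcut P F) ⊆ Z P := by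
  classical
  induction F using Finset.induction_on with
  | empty => rw [mcut_empty]
  | insert u F _ ih =>
    rw [mcut_insert]
    exact (h _ (hP.mcut F) ((_root_.mcut_subset P F).trans hW) u).trans ih

theorem IsSLValuation.subset_of_mcut_sub (hZ : IsSLValuation Z) {W K : Set (Euc n)}
    (hW : CutMono Z W) (hK : Convex ℝ K) [DecidableEq (Euc n)] {I : Finset (Euc n)}
    (hI : I.Nonempty) : ∀ {P : Set (Euc n)}, IsPolytope0 P → P ⊆ W →
      (∀ l ∈ I, Z (mcut P (I.image fun m => l - m)) ⊆ K) → Z P ⊆ K := by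
  induction hI using Finset.Nonempty.cons_induction with
  | singleton a =>
    intro P hP hPW h
    have h1 := h a (Finset.mem_singleton_self a)
    have : mcut P (({a} : Finset (Euc n)).image fun m => a - m) = P := by
      ext x
      simp [mem_mcut]
    rwa [this] at h1
  | cons a I ha hI ih =>
    intro P hP hPW h
    refine ih hP hPW fun l hl => ?_
    have hQ := hP.mcut (I.image fun m => l - m)
    have hQW := (_root_.mcut_subset P (I.image fun m => l - m)).trans hPW
    refine hZ.subset_of_cut_subset hQ hK (l - a) ?_ ?_
    · have h1 := h l (Finset.mem_cons_of_mem hl)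
      rwa [Finset.cons_eq_insert, Finset.image_insert, mcut_insert] at h1
    · have h1 := h a (Finset.mem_cons_self a I)
      refine Set.Subset.trans ?_ h1
      have h2 : cut (mcut P (I.image fun m => l - m)) (-(l - a)) =
          mcut (mcut P ((Finset.cons a I ha).image fun m => a - m))
            (insert (a - l) (I.image fun m => l - m)) := by
        ext x
        simp only [mem_cut, mem_mcut, Finset.forall_mem_image, Finset.forall_mem_insert,
          Finset.cons_eq_insert, neg_sub, inner_sub_left, sub_self]
        constructor
        · rintro ⟨⟨h3, h4⟩, h5⟩
          exact ⟨⟨h3, le_rfl, fun y hy => by linarith [h4 hy]⟩, h5, h4⟩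
        · rintro ⟨⟨h3, -, -⟩, h5, h4⟩
          exact ⟨⟨h3, h4⟩, h5⟩
      rw [h2]
      exact hW.mcut_subset (hP.mcut _) ((_root_.mcut_subset _ _).trans hPW) _

/-- To bound `Z P`, it suffices to bound `Z` on the pyramids with apex at the origin over the
facets of `P` not containing the origin. -/
theorem IsSLValuation.subset_of_pieces (hZ : IsSLValuation Z) {W K : Set (Euc n)}
    (hW : CutMono Z W) (hK : Convex ℝ K) {P : Set (Euc n)} (hP : IsPolytope0 P) (hPW : P ⊆ W)
    (h : ∀ (X : Set (Euc n)) (l : Euc n) (F : Finset (Euc n)), IsPolytope0 X → X ⊆ P →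
      (∀ x ∈ P, ⟪l, x⟫ ≤ 1) → (∀ x, x ∈ X ↔ ⟪l, x⟫ ≤ 1 ∧ ∀ u ∈ F, 0 ≤ ⟪u, x⟫) → Z X ⊆ K) :
    Z P ⊆ K := by
  classical
  obtain ⟨I, J, hIJ⟩ := hP.exists_inequalities
  refine hZ.subset_of_mcut_sub hW hK (Finset.insert_nonempty 0 I) hP hPW fun l hl => ?_
  have hle : ∀ x, x ∈ P → ∀ m ∈ insert 0 I, ⟪m, x⟫ ≤ 1 := by
    intro x hx m hm
    rcases Finset.mem_insert.1 hm with rfl | hm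
    · simp
    · exact ((hIJ x).1 hx).1 m hm
  refine h _ l (J ∪ (insert 0 I).image fun m => l - m) (hP.mcut _) (_root_.mcut_subset _ _)
    (fun x hx => hle x hx l hl) fun x => ?_
  rw [mem_mcut, Finset.forall_mem_union]
  constructor
  · rintro ⟨hx, h1⟩
    exact ⟨hle x hx l hl, ((hIJ x).1 hx).2, h1⟩
  · rintro ⟨hx, h1, h2⟩
    refine ⟨(hIJ x).2 ⟨fun m hm => ?_, h1⟩, h2⟩
    have := h2 (l - m) (Finset.mem_image_of_mem _ (Finset.mem_insert_of_mem hm))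
    rw [inner_sub_left] at this
    linarith

/-- In a bounded pyramid the functional `l` is positive away from the apex. -/
theorem inner_pos_of_mem_pyramid {X : Set (Euc n)} {l : Euc n} {F : Finset (Euc n)}
    (hXb : Bornology.IsBounded X)
    (hX : ∀ x, x ∈ X ↔ ⟪l, x⟫ ≤ 1 ∧ ∀ u ∈ F, 0 ≤ ⟪u, x⟫) {x : Euc n} (hx : x ∈ X)
    (hx0 : x ≠ 0) : 0 < ⟪l, x⟫ := by
  by_contra! hneg
  obtain ⟨R, hR⟩ := hXb.exists_norm_le
  have hxn : 0 < ‖x‖ := norm_pos_iff.2 hx0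
  have hR0 : 0 ≤ R := (norm_nonneg x).trans (hR x hx)
  have h1 : ((R + 1) / ‖x‖) • x ∈ X := by
    have h2 : 0 ≤ (R + 1) / ‖x‖ := by positivity
    refine (hX _).2 ⟨?_, fun u hu => ?_⟩
    · rw [inner_smul_right]
      nlinarith [mul_nonneg h2 (neg_nonneg.2 hneg)]
    · rw [inner_smul_right]
      exact mul_nonneg h2 (((hX x).1 hx).2 u hu)
  have h2 := hR _ h1
  rw [norm_smul, Real.norm_of_nonneg (by positivity), div_mul_cancel₀ _ hxn.ne'] at h2
  linarith

/-- A bounded pyramid over a facet is cut out of a simplex by half-spaces. -/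
theorem exists_eq_mcut_splx {X : Set (Euc n)} {l : Euc n} {F : Finset (Euc n)}
    (hXb : Bornology.IsBounded X) (hX : ∀ x, x ∈ X ↔ ⟪l, x⟫ ≤ 1 ∧ ∀ u ∈ F, 0 ≤ ⟪u, x⟫)
    {b : Fin n → Euc n} (hb : vdet b ≠ 0) {S : Finset (Fin n)} (hS : S.Nonempty)
    (hl : ∀ i ∈ S, ⟪l, b i⟫ = 1) (hXS : ∀ x ∈ X, ∀ i ∉ S, (vbasis b hb).equivFun x i = 0) :
    ∃ w : Fin n → Euc n, vdet w ≠ 0 ∧ (∀ i ∉ S, w i = b i) ∧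
      (∀ i ∈ S, w i ∈ Submodule.span ℝ (b '' S)) ∧ (∀ i ∈ S, ⟪l, w i⟫ = 1) ∧
      X = mcut (splx w S) F := by
  classical
  let β := (vbasis b hb).equivFun
  obtain ⟨R₀, hR₀⟩ : ∃ R₀ : ℝ, ∀ x ∈ X, ‖β x‖ ≤ R₀ := by
    obtain ⟨C, hC⟩ := hXb.exists_norm_le
    refine ⟨‖(LinearMap.toContinuousLinearMap (β : Euc n →ₗ[ℝ] (Fin n → ℝ)))‖ * C, fun x hx => ?_⟩
    exact (ContinuousLinearMap.le_opNorm
      (LinearMap.toContinuousLinearMap (β : Euc n →ₗ[ℝ] (Fin n → ℝ))) x).trans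
      (mul_le_mul_of_nonneg_left (hC x hx) (norm_nonneg _))
  set R := max R₀ 0 with hRdef
  have hR0 : 0 ≤ R := le_max_right _ _
  have hR : ∀ x ∈ X, ∀ i, |β x i| ≤ R := fun x hx i =>
    (norm_le_pi_norm (β x) i).trans ((hR₀ x hx).trans (le_max_left _ _))
  set d : ℝ := (S.card : ℝ) with hd
  have hd0 : 0 < d := by rw [hd]; exact_mod_cast hS.card_pos
  set M : ℝ := 1 + d * R with hM
  have hM0 : 0 < M := by positivity
  obtain ⟨c, hc⟩ : ∃ c : Euc n, c = d⁻¹ • ∑ i ∈ S, b i := ⟨_, rfl⟩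
  have hsb : ∑ i ∈ S, b i = d • c := by rw [hc, smul_inv_smul₀ hd0.ne']
  let w : Fin n → Euc n := fun i => if i ∈ S then (1 - M) • c + M • b i else b i
  have hwS : ∀ i ∈ S, w i = (1 - M) • c + M • b i := fun i hi => if_pos hi
  have hwS' : ∀ i ∉ S, w i = b i := fun i hi => if_neg hi
  have hsw : ∑ i ∈ S, w i = d • c := by
    rw [Finset.sum_congr rfl hwS, Finset.sum_add_distrib, ← Finset.smul_sum (f := b), hsb,
      Finset.sum_const, ← Nat.cast_smul_eq_nsmul ℝ, smul_smul, smul_smul, ← add_smul]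
    congr 1
    ring
  have hcspan : c ∈ Submodule.span ℝ (b '' S) := by
    rw [hc]
    exact Submodule.smul_mem _ _ (Submodule.sum_mem _ fun i hi =>
      Submodule.subset_span ⟨i, hi, rfl⟩)
  have hlc : ⟪l, c⟫ = 1 := by
    rw [hc, inner_smul_right, inner_sum, Finset.sum_congr rfl hl, Finset.sum_const, nsmul_eq_mul,
      mul_one, inv_mul_cancel₀ hd0.ne']
  have hlw : ∀ i ∈ S, ⟪l, w i⟫ = 1 := fun i hi => by
    rw [hwS i hi, inner_add_right, inner_smul_right, inner_smul_right, hlc, hl i hi]; ring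
  refine ⟨w, vdet_ne_zero_of_linearIndependent ?_, hwS', fun i hi => ?_, hlw, ?_⟩
  · refine linearIndependent_of_top_le_span_of_card_eq_finrank ?_ (by simp)
    rw [← (vbasis b hb).span_eq, coe_vbasis, Submodule.span_le]
    have hcw : c ∈ Submodule.span ℝ (Set.range w) := by
      have : c = d⁻¹ • ∑ i ∈ S, w i := by rw [hsw, inv_smul_smul₀ hd0.ne']
      rw [this]
      exact Submodule.smul_mem _ _ (Submodule.sum_mem _ fun i hi => Submodule.subset_span ⟨i, rfl⟩)
    rintro _ ⟨i, rfl⟩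
    have hwi : w i ∈ Submodule.span ℝ (Set.range w) := Submodule.subset_span ⟨i, rfl⟩
    by_cases hi : i ∈ S
    · have : b i = M⁻¹ • (w i - (1 - M) • c) := by
        rw [hwS i hi, add_sub_cancel_left, inv_smul_smul₀ hM0.ne']
      rw [this]
      exact Submodule.smul_mem _ _ (Submodule.sub_mem _ hwi (Submodule.smul_mem _ _ hcw))
    · rw [← hwS' i hi]; exact hwi
  · rw [hwS i hi]
    exact Submodule.add_mem _ (Submodule.smul_mem _ _ hcspan)
      (Submodule.smul_mem _ _ (Submodule.subset_span ⟨i, hi, rfl⟩))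
  · apply subset_antisymm
    · intro x hx
      refine ⟨?_, ((hX x).1 hx).2⟩
      by_cases hx0 : x = 0
      · rw [hx0]; exact (isPolytope0_splx w S).2
      have hs := inner_pos_of_mem_pyramid hXb hX hx hx0
      set s := ⟪l, x⟫ with hsdef
      have hxs : s⁻¹ • x ∈ X := by
        refine (hX _).2 ⟨?_, fun u hu => ?_⟩
        · rw [inner_smul_right, ← hsdef, inv_mul_cancel₀ hs.ne']
        · rw [inner_smul_right]
          exact mul_nonneg (inv_nonneg.2 hs.le) (((hX x).1 hx).2 u hu)
      have hβ : ∀ i, |β x i| ≤ R * s := fun i => by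
        have := hR _ hxs i
        rw [map_smul, Pi.smul_apply, smul_eq_mul, abs_mul, abs_of_pos (inv_pos.2 hs),
          inv_mul_le_iff₀ hs] at this
        linarith
      have hxsum : ∑ i ∈ S, β x i • b i = x := by
        conv_rhs => rw [← (vbasis b hb).sum_equivFun x]
        simp only [vbasis_apply]
        refine Finset.sum_subset (Finset.subset_univ S) fun i _ hi => ?_
        rw [show β x i = 0 from hXS x hx i hi, zero_smul]
      have hssum : ∑ i ∈ S, β x i = s := by
        rw [hsdef]
        conv_rhs => rw [← hxsum]
        rw [inner_sum]
        refine Finset.sum_congr rfl fun i hi => ?_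
        rw [inner_smul_right, hl i hi, mul_one]
      let g : Fin n → ℝ := fun i => if i ∈ S then β x i / M + s * (1 - 1 / M) / d else 0
      have hgS : ∀ i ∈ S, g i = β x i / M + s * (1 - 1 / M) / d := fun i hi => if_pos hi
      have hgS' : ∀ i ∉ S, g i = 0 := fun i hi => if_neg hi
      refine mem_splx_iff.2 ⟨g, fun i => ?_, hgS', ?_, ?_⟩
      · by_cases hi : i ∈ S
        · rw [hgS i hi]
          have h1 := neg_le_of_abs_le (hβ i)
          have h2 : β x i / M + s * (1 - 1 / M) / d = (β x i + R * s) / M := by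
            rw [hM]
            field_simp
            ring
          rw [h2]
          exact div_nonneg (by linarith) hM0.le
        · rw [hgS' i hi]
      · rw [← Finset.sum_subset (Finset.subset_univ S) fun i _ hi => hgS' i hi,
          Finset.sum_congr rfl hgS, Finset.sum_add_distrib, ← Finset.sum_div, hssum,
          Finset.sum_const, nsmul_eq_mul, ← hd, mul_div_cancel₀ _ hd0.ne']
        have : s / M + s * (1 - 1 / M) = s := by field_simp; ring
        rw [this]
        exact ((hX x).1 hx).1
      · rw [← Finset.sum_subset (Finset.subset_univ S) fun i _ hi => by rw [hgS' i hi, zero_smul]]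
        have : ∀ i ∈ S, g i • w i = (β x i * ((1 - M) / M)) • c + β x i • b i +
            (s * (1 - 1 / M) / d) • w i := fun i hi => by
          rw [hgS i hi, add_smul]
          congr 1
          rw [hwS i hi, smul_add, smul_smul, smul_smul, div_mul_cancel₀ _ hM0.ne']
          congr 2
          ring
        rw [Finset.sum_congr rfl this, Finset.sum_add_distrib, Finset.sum_add_distrib, hxsum,
          ← Finset.smul_sum, hsw, ← Finset.sum_smul, ← Finset.sum_mul, hssum, smul_smul,
          add_right_comm, ← add_smul]
        have : s * ((1 - M) / M) + s * (1 - 1 / M) / d * d = 0 := by field_simp; ring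
        rw [this, zero_smul, zero_add]
    · rintro x ⟨hx, hxF⟩
      refine (hX x).2 ⟨?_, hxF⟩
      exact splx_subset (K := {x | ⟪l, x⟫ ≤ 1})
        (convex_halfSpace_le (innerₗ (Euc n) l).isLinear 1) (by simp)
        (fun i hi => (hlw i hi).le) hx

theorem span_inter_level_eq {W : Submodule ℝ (Euc n)} {l p : Euc n} (hp : p ∈ W)
    (hlp : ⟪l, p⟫ ≠ 0) : Submodule.span ℝ {x | x ∈ W ∧ ⟪l, x⟫ = 1} = W := by
  refine le_antisymm (Submodule.span_le.2 fun x hx => hx.1) fun y hy => ?_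
  have key : ∀ y ∈ W, ⟪l, y⟫ ≠ 0 → y ∈ Submodule.span ℝ {x | x ∈ W ∧ ⟪l, x⟫ = 1} := by
    intro y hy h
    rw [← smul_inv_smul₀ h y]
    refine Submodule.smul_mem _ _ (Submodule.subset_span ⟨W.smul_mem _ hy, ?_⟩)
    rw [inner_smul_right, inv_mul_cancel₀ h]
  by_cases h : ⟪l, y⟫ = 0
  · rw [← add_sub_cancel_right y p]
    exact Submodule.sub_mem _ (key _ (W.add_mem hy hp) (by rwa [inner_add_right, h, zero_add]))
      (key p hp hlp)
  · exact key y hy h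

theorem exists_fin_family_span_eq {A : Set (Euc n)} {m : ℕ} {W : Submodule ℝ (Euc n)}
    (hA : Submodule.span ℝ A = W) (hm : Module.finrank ℝ W = m) :
    ∃ b : Fin m → Euc n, (∀ i, b i ∈ A) ∧ Submodule.span ℝ (Set.range b) = W ∧
      LinearIndependent ℝ b := by
  subst hA
  subst hm
  exact Submodule.exists_fun_fin_finrank_span_eq ℝ A

theorem exists_basis_mem {A : Set (Euc n)} (hA : Submodule.span ℝ A = ⊤) :
    ∃ b : Fin n → Euc n, vdet b ≠ 0 ∧ ∀ i, b i ∈ A := by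
  obtain ⟨b, hb, -, hli⟩ := exists_fin_family_span_eq hA (m := n) (by simp)
  exact ⟨b, vdet_ne_zero_of_linearIndependent hli, hb⟩

theorem exists_basis_orthogonal {u l p : Euc n} (hu : u ≠ 0) (hp : ⟪u, p⟫ = 0)
    (hlp : ⟪l, p⟫ ≠ 0) : ∃ (b : Fin n → Euc n) (k : Fin n), vdet b ≠ 0 ∧ b k = u ∧
      ∀ i, i ≠ k → ⟪u, b i⟫ = 0 ∧ ⟪l, b i⟫ = 1 := by
  obtain _ | m := n
  · exact absurd (Subsingleton.elim _ _) hu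
  have hpW : p ∈ (ℝ ∙ u)ᗮ := Submodule.mem_orthogonal_singleton_iff_inner_right.2 hp
  have : Fact (Module.finrank ℝ (Euc (m + 1)) = m + 1) := ⟨by simp⟩
  obtain ⟨b, hb, hspan, hli⟩ := exists_fin_family_span_eq (span_inter_level_eq hpW hlp)
    (m := m) (Submodule.finrank_orthogonal_span_singleton hu)
  refine ⟨Fin.cons u b, 0, vdet_ne_zero_of_linearIndependent ?_, Fin.cons_zero _ _, ?_⟩
  · refine linearIndependent_finCons.2 ⟨hli, fun h => hu ?_⟩
    rw [hspan, Submodule.mem_orthogonal_singleton_iff_inner_right] at h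
    exact inner_self_eq_zero.1 h
  · intro i hi
    obtain ⟨j, rfl⟩ := Fin.exists_succ_eq.2 hi
    rw [Fin.cons_succ]
    exact ⟨Submodule.mem_orthogonal_singleton_iff_inner_right.1 (hb j).1, (hb j).2⟩

namespace IsSLValuation

theorem cutMono_orthogonal (hZ : IsSLValuation Z) {u : Euc n} (hu : u ≠ 0) :
    CutMono Z {x | ⟪u, x⟫ = 0} := by
  intro P hP hPu v
  by_cases h : LinearIndependent ℝ ![u, v]
  · exact hZ.cut_subset_of_inter_eq_zero hP v <|
      hZ.eq_zero_of_orthogonal_pair ((hP.cut v).cut _) h (fun x hx => hPu hx.1.1)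
        fun x hx => inner_eq_zero_of_mem_cut_cut hx
  · have hv : ∃ a : ℝ, a • u = v := by
      by_contra! hcon
      exact h ((LinearIndependent.pair_iff' hu).2 hcon)
    obtain ⟨a, rfl⟩ := hv
    have : cut P (a • u) = P := by
      refine subset_antisymm (cut_subset _ _) fun x hx => ⟨hx, ?_⟩
      rw [inner_smul_left, show ⟪u, x⟫ = 0 from hPu hx, mul_zero]
    rw [this]

theorem singleton_zero (hZ : IsSLValuation Z) (hn : 2 ≤ n) : Z {0} = {0} := by
  have hf : Module.finrank ℝ (Euc n) = n := by simp
  have : Nontrivial (Euc n) := Module.nontrivial_of_finrank_pos (R := ℝ) (by omega)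
  obtain ⟨u, hu⟩ := exists_ne (0 : Euc n)
  obtain ⟨v, h⟩ := exists_linearIndependent_pair_of_one_lt_finrank (R := ℝ) (by omega) hu
  refine hZ.eq_zero_of_orthogonal_pair ⟨⟨{0}, by simp⟩, rfl⟩ h ?_ ?_ <;> simp

/-- `Z` vanishes on lower-dimensional polytopes. -/
theorem eq_zero_of_orthogonal (hZ : IsSLValuation Z) (hn : 3 ≤ n) {P : Set (Euc n)}
    (hP : IsPolytope0 P) {u : Euc n} (hu : u ≠ 0) (hPu : ∀ x ∈ P, ⟪u, x⟫ = 0) : Z P = {0} := by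
  classical
  refine subset_antisymm ?_ (Set.singleton_subset_iff.2 (hZ.body P hP).2.2)
  refine hZ.subset_of_pieces (hZ.cutMono_orthogonal hu) (convex_singleton 0) hP hPu ?_
  intro X l F hX hXP _ hXF
  by_cases h : X ⊆ {0}
  · rw [subset_antisymm h (Set.singleton_subset_iff.2 hX.2), hZ.singleton_zero (by omega)]
  obtain ⟨p, hp, hp0⟩ := Set.not_subset.1 h
  have hXb := hX.isConvexBody0.1.isBounded
  have hlp := inner_pos_of_mem_pyramid hXb hXF hp hp0
  obtain ⟨b, k, hb, hbk, hbi⟩ := exists_basis_orthogonal hu (hPu p (hXP hp)) hlp.ne'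
  obtain ⟨j, hj⟩ : ∃ j, j ≠ k := by
    have : Nontrivial (Fin n) := Fin.nontrivial_iff_two_le.2 (by omega)
    exact exists_ne k
  have hmem : ∀ i, i ∈ ({k}ᶜ : Finset (Fin n)) ↔ i ≠ k := by simp
  obtain ⟨w, hw, hwk, hwi, -, hXw⟩ := exists_eq_mcut_splx (S := {k}ᶜ) hXb hXF hb
    ⟨j, (hmem j).2 hj⟩ (fun i hi => (hbi i ((hmem i).1 hi)).2) (by
      intro x hx i hi
      obtain rfl : i = k := by simpa using hi
      have h1 := hPu x (hXP hx)
      rw [← (vbasis b hb).sum_equivFun x, inner_sum, Finset.sum_eq_single i] at h1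
      · rw [vbasis_apply, inner_smul_right, hbk] at h1
        exact (mul_eq_zero.1 h1).resolve_right (inner_self_ne_zero.2 hu)
      · intro j _ hj
        rw [vbasis_apply, inner_smul_right, (hbi j hj).1, mul_zero]
      · simp)
  have hwk' : w k = u := (hwk k (by simp)).trans hbk
  have hws : ∀ i, i ≠ k → ⟪u, w i⟫ = 0 := fun i hi => by
    have h1 : Submodule.span ℝ (b '' (({k}ᶜ : Finset (Fin n)) : Set (Fin n))) ≤ (ℝ ∙ u)ᗮ := by
      rw [Submodule.span_le]
      rintro _ ⟨j, hj, rfl⟩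
      exact Submodule.mem_orthogonal_singleton_iff_inner_right.2 (hbi j ((hmem j).1 hj)).1
    exact Submodule.mem_orthogonal_singleton_iff_inner_right.1 (h1 (hwi i ((hmem i).2 hi)))
  have hT : Z (splx w {k}ᶜ) = {0} := hZ.splx_compl_eq_zero hn hw k (by rwa [hwk'])
  rw [hXw, ← hT]
  rw [Finset.coe_compl, Finset.coe_singleton]
  refine (hZ.cutMono_orthogonal hu).mcut_subset (isPolytope0_splx _ _) ?_ F
  exact splx_subset (convex_hyperplane (innerₗ (Euc n) u).isLinear 0) (by simp) hws

theorem cutMono_univ (hZ : IsSLValuation Z) (hn : 3 ≤ n) : CutMono Z Set.univ := by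
  intro P hP _ u
  by_cases hu : u = 0
  · have : cut P u = P := by
      refine subset_antisymm (cut_subset _ _) fun x hx => ⟨hx, ?_⟩
      rw [hu, inner_zero_left]
    rw [this]
  · exact hZ.cut_subset_of_inter_eq_zero hP u <|
      hZ.eq_zero_of_orthogonal hn ((hP.cut u).cut _) hu
        fun x hx => inner_eq_zero_of_mem_cut_cut hx

end IsSLValuation

end

section

variable {n : ℕ} {Z : Set (Euc n) → Set (Euc n)}

theorem splx_comp_equiv (w : Fin n → Euc n) (e : Equiv.Perm (Fin n)) :
    splx (w ∘ e) Set.univ = splx w Set.univ := by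
  rw [splx, splx, Set.image_comp, Set.image_univ, e.surjective.range_eq]

theorem exists_ne_ne_ne (hn : 3 ≤ n) (k : Fin n) : ∃ i j : Fin n, i ≠ j ∧ i ≠ k ∧ j ≠ k := by
  have h : 1 < (Finset.univ.erase k).card := by
    rw [Finset.card_erase_of_mem (Finset.mem_univ k), Finset.card_univ, Fintype.card_fin]
    omega
  obtain ⟨i, hi, j, hj, hij⟩ := Finset.one_lt_card.1 h
  exact ⟨i, j, hij, Finset.ne_of_mem_erase hi, Finset.ne_of_mem_erase hj⟩

namespace IsSLValuation

theorem supp_splx_eq_max (hZ : IsSLValuation Z) (hn : 3 ≤ n) {w : Fin n → Euc n}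
    (hw : vdet w ≠ 0) {i j : Fin n} (hij : i ≠ j) {a b : ℝ} (ha : 0 < a) (hb : 0 < b)
    (hab : a + b = 1) (x : Euc n) :
    supp (Z (splx w Set.univ)) x =
      max (supp (Z (splx (Function.update w j (a • w i + b • w j)) Set.univ)) x)
        (supp (Z (splx (Function.update w i (b • w j + a • w i)) Set.univ)) x) := by
  obtain ⟨u, hu, hc1, hc2⟩ := exists_cut_splx hw hij (Set.mem_univ i) (Set.mem_univ j) ha hb hab
  have hu0 : u ≠ 0 := by
    rintro rfl
    have := hu i
    rw [inner_zero_left, if_pos rfl] at this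
    exact hb.ne this
  have hP := isPolytope0_splx w Set.univ
  rw [hZ.supp_eq_max hP u (hZ.eq_zero_of_orthogonal hn ((hP.cut u).cut _) hu0
    fun x hx => inner_eq_zero_of_mem_cut_cut hx), hc1, hc2]

theorem supp_splx_eq_of_vdet_eq (hZ : IsSLValuation Z) {w w' : Fin n → Euc n}
    (hw : vdet w ≠ 0) (h : vdet w' = vdet w) (s : ℝ) (k : Fin n) :
    supp (Z (splx w' Set.univ)) (s • w' k) = supp (Z (splx w Set.univ)) (s • w k) := by
  obtain ⟨f, hf, hfs⟩ := hZ.exists_supp_splx hw h Set.univ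
  rw [← hfs, map_smul, hf]

theorem supp_splx_sub_eq_of_vdet_eq (hZ : IsSLValuation Z) {w w' : Fin n → Euc n}
    (hw : vdet w ≠ 0) (h : vdet w' = vdet w) (i j : Fin n) :
    supp (Z (splx w' Set.univ)) (w' i - w' j) = supp (Z (splx w Set.univ)) (w i - w j) := by
  obtain ⟨f, hf, hfs⟩ := hZ.exists_supp_splx hw h Set.univ
  rw [← hfs, map_sub, hf, hf]

theorem supp_splx_le_of_vdet_lt (hZ : IsSLValuation Z) (hn : 3 ≤ n) {w w' : Fin n → Euc n}
    (hw : vdet w ≠ 0) {t : ℝ} (ht : 0 < t) (ht1 : t < 1) (h : vdet w' = t * vdet w) (s : ℝ)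
    (k : Fin n) :
    supp (Z (splx w' Set.univ)) (s • w' k) ≤ supp (Z (splx w Set.univ)) (s • w k) := by
  obtain ⟨i, j, hij, -, hjk⟩ := exists_ne_ne_ne hn k
  have h1 := hZ.supp_splx_eq_max hn hw hij (sub_pos.2 ht1) ht (by ring) (s • w k)
  have hd := vdet_update_left w hij (1 - t) t
  have h2 := hZ.supp_splx_eq_of_vdet_eq (w := Function.update w j ((1 - t) • w i + t • w j))
    (w' := w') (by rw [hd]; exact mul_ne_zero ht.ne' hw) (by rw [hd, h]) s k
  rw [Function.update_of_ne hjk.symm] at h2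
  rw [h1, h2]
  exact le_max_left _ _

theorem supp_splx_eq_of_vdet_half (hZ : IsSLValuation Z) (hn : 3 ≤ n) {w w' : Fin n → Euc n}
    (hw : vdet w ≠ 0) (h : vdet w' = 1 / 2 * vdet w) (s : ℝ) (k : Fin n) :
    supp (Z (splx w' Set.univ)) (s • w' k) = supp (Z (splx w Set.univ)) (s • w k) := by
  obtain ⟨i, j, hij, hik, hjk⟩ := exists_ne_ne_ne hn k
  have hw' : vdet w' ≠ 0 := by rw [h]; exact mul_ne_zero (by norm_num) hw
  have h1 := hZ.supp_splx_eq_max hn hw hij (a := 1 / 2) (b := 1 / 2) (by norm_num) (by norm_num)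
    (by norm_num) (s • w k)
  have h2 := hZ.supp_splx_eq_of_vdet_eq hw' ((vdet_update_left w hij (1 / 2) (1 / 2)).trans h.symm)
    s k
  have h3 := hZ.supp_splx_eq_of_vdet_eq hw'
    ((vdet_update_left w hij.symm (1 / 2) (1 / 2)).trans h.symm) s k
  rw [Function.update_of_ne hjk.symm] at h2
  rw [Function.update_of_ne hik.symm] at h3
  rw [h1, h2, h3, max_self]

theorem supp_splx_eq_of_vdet_half_pow (hZ : IsSLValuation Z) (hn : 3 ≤ n) {w : Fin n → Euc n}
    (hw : vdet w ≠ 0) (m : ℕ) : ∀ {w' : Fin n → Euc n}, vdet w' = (1 / 2) ^ m * vdet w →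
      ∀ (s : ℝ) (k : Fin n),
        supp (Z (splx w' Set.univ)) (s • w' k) = supp (Z (splx w Set.univ)) (s • w k) := by
  induction m with
  | zero =>
    intro w' h s k
    exact hZ.supp_splx_eq_of_vdet_eq hw (by rw [h]; ring) s k
  | succ m ih =>
    intro w' h s k
    have h1 := vdet_update_smul w k ((1 / 2 : ℝ) ^ m)
    rw [hZ.supp_splx_eq_of_vdet_half hn (w := Function.update w k (((1 / 2 : ℝ) ^ m) • w k))
      (by rw [h1]; exact mul_ne_zero (by positivity) hw) (by rw [h1, h]; ring), ih h1]

theorem supp_splx_eq_of_vdet_lt (hZ : IsSLValuation Z) (hn : 3 ≤ n) {w w' : Fin n → Euc n}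
    (hw : vdet w ≠ 0) {t : ℝ} (ht : 0 < t) (ht1 : t < 1) (h : vdet w' = t * vdet w) (s : ℝ)
    (k : Fin n) :
    supp (Z (splx w' Set.univ)) (s • w' k) = supp (Z (splx w Set.univ)) (s • w k) := by
  refine le_antisymm (hZ.supp_splx_le_of_vdet_lt hn hw ht ht1 h s k) ?_
  obtain ⟨m, hm⟩ := exists_pow_lt_of_lt_one ht (by norm_num : (1 / 2 : ℝ) < 1)
  have h1 := vdet_update_smul w k ((1 / 2 : ℝ) ^ m)
  rw [← hZ.supp_splx_eq_of_vdet_half_pow hn hw m h1]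
  refine hZ.supp_splx_le_of_vdet_lt hn (by rw [h]; exact mul_ne_zero ht.ne' hw)
    (t := (1 / 2) ^ m / t) (by positivity) ((div_lt_one ht).2 hm) ?_ s k
  rw [h1, h, ← mul_assoc, div_mul_cancel₀ _ ht.ne']

theorem supp_splx_eq_of_vdet_pos_mul (hZ : IsSLValuation Z) (hn : 3 ≤ n) {w w' : Fin n → Euc n}
    (hw : vdet w ≠ 0) {t : ℝ} (ht : 0 < t) (h : vdet w' = t * vdet w) (s : ℝ) (k : Fin n) :
    supp (Z (splx w' Set.univ)) (s • w' k) = supp (Z (splx w Set.univ)) (s • w k) := by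
  rcases lt_trichotomy t 1 with h1 | rfl | h1
  · exact hZ.supp_splx_eq_of_vdet_lt hn hw ht h1 h s k
  · exact hZ.supp_splx_eq_of_vdet_eq hw (by rw [h, one_mul]) s k
  · refine (hZ.supp_splx_eq_of_vdet_lt hn (t := t⁻¹) (by rw [h]; exact mul_ne_zero ht.ne' hw)
      (inv_pos.2 ht) (inv_lt_one_of_one_lt₀ h1) ?_ s k).symm
    rw [h, inv_mul_cancel_left₀ ht.ne']

theorem supp_splx_eq_of_vdet_ne_zero (hZ : IsSLValuation Z) (hn : 3 ≤ n) {w w' : Fin n → Euc n}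
    (hw : vdet w ≠ 0) (hw' : vdet w' ≠ 0) (s : ℝ) (k : Fin n) :
    supp (Z (splx w' Set.univ)) (s • w' k) = supp (Z (splx w Set.univ)) (s • w k) := by
  have h : vdet w' = vdet w' / vdet w * vdet w := (div_mul_cancel₀ _ hw).symm
  rcases (div_ne_zero hw' hw).lt_or_gt with ht | ht
  · obtain ⟨i, j, hij, hik, hjk⟩ := exists_ne_ne_ne hn k
    have h1 := vdet_comp_swap w' hij
    have h2 := hZ.supp_splx_eq_of_vdet_pos_mul hn hw (neg_pos.2 ht)
      (by rw [h1, neg_mul, ← h]) s k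
    rwa [splx_comp_equiv, Function.comp_apply, Equiv.swap_apply_of_ne_of_ne hik.symm hjk.symm]
      at h2
  · exact hZ.supp_splx_eq_of_vdet_pos_mul hn hw ht h s k

/-- The support function of `Z T` takes the same values at the vertices of all simplices `T`. -/
theorem exists_supp_splx_eq (hZ : IsSLValuation Z) (hn : 3 ≤ n) (s : ℝ) :
    ∃ a : ℝ, 0 ≤ a ∧ ∀ w : Fin n → Euc n, vdet w ≠ 0 → ∀ k,
      supp (Z (splx w Set.univ)) (s • w k) = a := by
  obtain ⟨w₀, hw₀⟩ : ∃ w₀ : Fin n → Euc n, vdet w₀ ≠ 0 :=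
    ⟨_, vdet_ne_zero_of_linearIndependent
      (EuclideanSpace.basisFun (Fin n) ℝ).toBasis.linearIndependent⟩
  let k₀ : Fin n := ⟨0, by omega⟩
  refine ⟨supp (Z (splx w₀ Set.univ)) (s • w₀ k₀),
    (hZ.body _ (isPolytope0_splx _ _)).supp_nonneg _, fun w hw k => ?_⟩
  rw [hZ.supp_splx_eq_of_vdet_ne_zero hn hw₀ hw]
  by_cases hk : k = k₀
  · rw [hk]
  · have h := hZ.supp_splx_eq_of_vdet_ne_zero hn hw₀ (w' := w₀ ∘ Equiv.swap k k₀)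
      (by rw [vdet_comp_swap _ hk]; exact neg_ne_zero.2 hw₀) s k₀
    rwa [splx_comp_equiv, Function.comp_apply, Equiv.swap_apply_right] at h

theorem supp_splx_sub_eq_two_mul (hZ : IsSLValuation Z) (hn : 3 ≤ n) {w w' : Fin n → Euc n}
    (hw : vdet w ≠ 0) (h : vdet w' = 1 / 2 * vdet w) {i j : Fin n} (hij : i ≠ j) :
    supp (Z (splx w Set.univ)) (w i - w j) = 2 * supp (Z (splx w' Set.univ)) (w' i - w' j) := by
  have hw' : vdet w' ≠ 0 := by rw [h]; exact mul_ne_zero (by norm_num) hw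
  have h1 := hZ.supp_splx_eq_max hn hw hij (a := 1 / 2) (b := 1 / 2) (by norm_num) (by norm_num)
    (by norm_num) (w i - w j)
  have h2 := hZ.supp_splx_sub_eq_of_vdet_eq hw'
    ((vdet_update_left w hij (1 / 2) (1 / 2)).trans h.symm) i j
  have h3 := hZ.supp_splx_sub_eq_of_vdet_eq hw'
    ((vdet_update_left w hij.symm (1 / 2) (1 / 2)).trans h.symm) i j
  rw [Function.update_of_ne hij, Function.update_self,
    show w i - ((1 / 2 : ℝ) • w i + (1 / 2 : ℝ) • w j) = (1 / 2 : ℝ) • (w i - w j) by module,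
    supp_smul (by norm_num)] at h2
  rw [Function.update_of_ne hij.symm, Function.update_self,
    show ((1 / 2 : ℝ) • w j + (1 / 2 : ℝ) • w i) - w j = (1 / 2 : ℝ) • (w i - w j) by module,
    supp_smul (by norm_num)] at h3
  rw [← h2] at h3
  have h4 := mul_left_cancel₀ (by norm_num) h3
  rw [h4, max_self] at h1
  rw [h1, ← h2]
  ring

theorem two_pow_mul_supp_splx_sub_le (hZ : IsSLValuation Z) (hn : 3 ≤ n) {C : ℝ}
    {i j : Fin n} (hij : i ≠ j)
    (hC : ∀ w, vdet w ≠ 0 → supp (Z (splx w Set.univ)) (w i - w j) ≤ C) (m : ℕ) :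
    ∀ w, vdet w ≠ 0 → 2 ^ m * supp (Z (splx w Set.univ)) (w i - w j) ≤ C := by
  induction m with
  | zero => simpa using hC
  | succ m ih =>
    intro w hw
    have h1 := vdet_update_smul w i 2
    have h2 : vdet (Function.update w i ((2 : ℝ) • w i)) ≠ 0 := by
      rw [h1]; exact mul_ne_zero two_ne_zero hw
    rw [pow_succ, mul_assoc,
      ← hZ.supp_splx_sub_eq_two_mul hn h2 (w' := w) (by rw [h1]; ring) hij]
    exact ih _ h2

/-- `Z T`, for a simplex `T` with one vertex at the origin, is a segment in the direction normal
to the opposite facet. -/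
theorem exists_splx_eq_segment (hZ : IsSLValuation Z) (hn : 3 ≤ n) :
    ∃ a b : ℝ, 0 ≤ a ∧ 0 ≤ b ∧ ∀ (w : Fin n → Euc n) (l : Euc n), vdet w ≠ 0 →
      (∀ i, ⟪l, w i⟫ = 1) → a • l ∈ Z (splx w Set.univ) ∧ (-b) • l ∈ Z (splx w Set.univ) ∧
        ∀ y ∈ Z (splx w Set.univ), ∃ t ∈ Set.Icc (-b) a, y = t • l := by
  obtain ⟨a, ha, haw⟩ := hZ.exists_supp_splx_eq hn 1
  obtain ⟨b, hb, hbw⟩ := hZ.exists_supp_splx_eq hn (-1)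
  simp only [one_smul, neg_smul] at haw hbw
  refine ⟨a, b, ha, hb, fun w l hw hl => ?_⟩
  have hB := fun w => hZ.body _ (isPolytope0_splx w Set.univ)
  have hle : ∀ w, vdet w ≠ 0 → ∀ i, ∀ y ∈ Z (splx w Set.univ), ⟪w i, y⟫ ≤ a := fun w hw i y hy =>
    ((hB w).inner_le_supp (w i) hy).trans_eq (haw w hw i)
  have hge : ∀ w, vdet w ≠ 0 → ∀ i, ∀ y ∈ Z (splx w Set.univ), -b ≤ ⟪w i, y⟫ :=
    fun w hw i y hy => by
      have := ((hB w).inner_le_supp (-w i) hy).trans_eq (hbw w hw i)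
      rw [inner_neg_left] at this
      linarith
  have hsub : ∀ {i j}, i ≠ j → ∀ w, vdet w ≠ 0 →
      supp (Z (splx w Set.univ)) (w i - w j) ≤ a + b := fun {i j} _ w hw =>
    (hB w).supp_le fun y hy => by
      rw [inner_sub_left]
      linarith [hle w hw i y hy, hge w hw j y hy]
  have hcmp : ∀ i j, ∀ y ∈ Z (splx w Set.univ), ⟪w i, y⟫ ≤ ⟪w j, y⟫ := by
    intro i j y hy
    by_cases hij : i = j
    · rw [hij]
    have h1 := (hB w).inner_le_supp (w i - w j) hy
    rw [inner_sub_left] at h1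
    by_contra! hlt
    obtain ⟨m, hm⟩ := pow_unbounded_of_one_lt ((a + b) / supp (Z (splx w Set.univ)) (w i - w j))
      (one_lt_two (α := ℝ))
    rw [div_lt_iff₀ (by linarith)] at hm
    exact hm.not_ge (hZ.two_pow_mul_supp_splx_sub_le hn hij (hsub hij) m w hw)
  have hseg : ∀ k, ∀ y ∈ Z (splx w Set.univ), y = ⟪w k, y⟫ • l := fun k y hy =>
    eq_of_inner_eq hw fun i => by
      rw [inner_smul_right, real_inner_comm l, hl i, mul_one]
      exact le_antisymm (hcmp i k y hy) (hcmp k i y hy)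
  let k : Fin n := ⟨0, by omega⟩
  refine ⟨?_, ?_, fun y hy => ⟨_, ⟨hge w hw k y hy, hle w hw k y hy⟩, hseg k y hy⟩⟩
  · obtain ⟨y, hy, h⟩ := (hB w).exists_inner_eq_supp (w k)
    rw [haw w hw] at h
    rw [← h, ← hseg k y hy]
    exact hy
  · obtain ⟨y, hy, h⟩ := (hB w).exists_inner_eq_supp (-w k)
    rw [hbw w hw, inner_neg_left] at h
    rw [← h, neg_neg, ← hseg k y hy]
    exact hy

end IsSLValuation

end

section

variable {n : ℕ} {Z : Set (Euc n) → Set (Euc n)}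

theorem finrank_span_eq_sdim_add_one {A : Set (Euc n)} {z p : Euc n} (hp : p ∈ A)
    (hA : ∀ x ∈ A, ⟪z, x⟫ = 1) : Module.finrank ℝ (Submodule.span ℝ A) = sdim A + 1 := by
  have hp0 : p ≠ 0 := by
    rintro rfl
    simpa using hA 0 hp
  have hsup : Submodule.span ℝ A = vectorSpan ℝ A ⊔ ℝ ∙ p := by
    rw [vectorSpan_eq_span_vsub_set_right ℝ hp]
    refine le_antisymm (Submodule.span_le.2 fun x hx => ?_) (sup_le (Submodule.span_le.2 ?_) ?_)
    · rw [← sub_add_cancel x p]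
      exact Submodule.add_mem_sup (Submodule.subset_span ⟨x, hx, rfl⟩)
        (Submodule.mem_span_singleton_self p)
    · rintro _ ⟨x, hx, rfl⟩
      exact Submodule.sub_mem _ (Submodule.subset_span hx) (Submodule.subset_span hp)
    · rw [Submodule.span_singleton_le_iff_mem]
      exact Submodule.subset_span hp
  have hinf : vectorSpan ℝ A ⊓ ℝ ∙ p = ⊥ := by
    rw [Submodule.eq_bot_iff]
    rintro x ⟨hx, hxp⟩
    obtain ⟨c, rfl⟩ := Submodule.mem_span_singleton.1 hxp
    have h1 := Submodule.mem_orthogonal_singleton_iff_inner_right.1 (vectorSpan_le_orthogonal hA hx)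
    rw [inner_smul_right, hA p hp, mul_one] at h1
    rw [h1, zero_smul]
  have h := Submodule.finrank_sup_add_finrank_inf_eq (vectorSpan ℝ A) (ℝ ∙ p)
  rw [hinf, finrank_bot, finrank_span_singleton hp0, ← hsup] at h
  rw [sdim_eq_finrank_vectorSpan, ← h, add_zero]

theorem span_eq_top_iff_sdim (hn : 1 ≤ n) {A : Set (Euc n)} {z p : Euc n} (hp : p ∈ A)
    (hA : ∀ x ∈ A, ⟪z, x⟫ = 1) : Submodule.span ℝ A = ⊤ ↔ sdim A = n - 1 := by
  have h := finrank_span_eq_sdim_add_one hp hA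
  constructor
  · intro ht
    rw [ht, finrank_top, finrank_euclideanSpace_fin] at h
    omega
  · intro ht
    refine Submodule.eq_top_of_finrank_eq ?_
    rw [h, finrank_euclideanSpace_fin]
    omega

theorem exists_basis_mem_face (hn : 1 ≤ n) {P : Set (Euc n)} (hP : IsConvexBody0 P) {z : Euc n}
    (hz : z ∈ facetPolars P) :
    ∃ w : Fin n → Euc n, vdet w ≠ 0 ∧ ∀ i, w i ∈ P ∧ ⟪z, w i⟫ = 1 := by
  obtain ⟨p, hp, hpz⟩ := hP.exists_inner_eq_supp z
  have hface : ∀ x ∈ face P z, ⟪z, x⟫ = 1 := fun x hx => hx.2.trans hz.1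
  have hpf : p ∈ face P z := ⟨hp, hpz⟩
  obtain ⟨w, hw, hwf⟩ := exists_basis_mem ((span_eq_top_iff_sdim hn hpf hface).2 hz.2)
  exact ⟨w, hw, fun i => ⟨(hwf i).1, hface _ (hwf i)⟩⟩

theorem exists_splx_eq_mcut {P : Set (Euc n)} (hP : IsConvexBody0 P) {z : Euc n}
    (hz : ∀ x ∈ P, ⟪z, x⟫ ≤ 1) {w : Fin n → Euc n} (hw : vdet w ≠ 0) (hwP : ∀ i, w i ∈ P)
    (hzw : ∀ i, ⟪z, w i⟫ = 1) : ∃ F, splx w Set.univ = mcut P F := by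
  classical
  choose u hu using fun i => exists_inner_family_eq hw (Pi.single i 1)
  have hcoord : ∀ i x, (vbasis w hw).equivFun x i = ⟪u i, x⟫ := fun i x => by
    conv_rhs => rw [← (vbasis w hw).sum_equivFun x]
    simp [inner_sum, inner_smul_right, vbasis_apply, hu, Pi.single_apply]
  have hsum : ∀ x, ∑ i, ⟪u i, x⟫ • w i = x := fun x => by
    conv_rhs => rw [← (vbasis w hw).sum_equivFun x]
    simp only [hcoord, vbasis_apply]
  refine ⟨Finset.univ.image u, Set.Subset.antisymm (fun x hx => mem_mcut.2 ⟨?_, ?_⟩)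
    fun x hx => ?_⟩
  · exact splx_subset hP.2.1 hP.2.2 (fun i _ => hwP i) hx
  · obtain ⟨c, hc, -, -, rfl⟩ := mem_splx_iff.1 hx
    intro v hv
    obtain ⟨i, -, rfl⟩ := Finset.mem_image.1 hv
    simpa [inner_sum, inner_smul_right, hu, Pi.single_apply] using hc i
  · refine mem_splx_iff.2 ⟨fun i => ⟪u i, x⟫,
      fun i => hx.2 _ (Finset.mem_image_of_mem u (Finset.mem_univ i)),
      fun i hi => absurd (Set.mem_univ i) hi, ?_, hsum x⟩
    have h1 := hz x hx.1
    rw [← hsum x] at h1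
    simpa only [inner_sum, inner_smul_right, hzw, mul_one] using h1

/-- A pyramid over a facet lies in a hyperplane or in a simplex with the same facet normal. -/
theorem orthogonal_or_eq_mcut_splx (hn : 1 ≤ n) {P X : Set (Euc n)} (hP : IsConvexBody0 P)
    {l : Euc n} {F : Finset (Euc n)} (hXb : Bornology.IsBounded X) (hXP : X ⊆ P)
    (hl : ∀ x ∈ P, ⟪l, x⟫ ≤ 1) (hX : ∀ x, x ∈ X ↔ ⟪l, x⟫ ≤ 1 ∧ ∀ u ∈ F, 0 ≤ ⟪u, x⟫) :
    (∃ u : Euc n, u ≠ 0 ∧ ∀ x ∈ X, ⟪u, x⟫ = 0) ∨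
      l ∈ facetPolars P ∧ ∃ w : Fin n → Euc n, vdet w ≠ 0 ∧ (∀ i, ⟪l, w i⟫ = 1) ∧
        X = mcut (splx w Set.univ) F := by
  by_cases hspan : Submodule.span ℝ X = ⊤
  · right
    have hA : Submodule.span ℝ {x | x ∈ X ∧ ⟪l, x⟫ = 1} = ⊤ := by
      rw [eq_top_iff, ← hspan, Submodule.span_le]
      intro x hx
      by_cases hx0 : x = 0
      · rw [hx0]; exact Submodule.zero_mem _
      have hs := inner_pos_of_mem_pyramid hXb hX hx hx0
      rw [← smul_inv_smul₀ hs.ne' x]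
      have h1 : ⟪l, (⟪l, x⟫)⁻¹ • x⟫ = 1 := by rw [inner_smul_right, inv_mul_cancel₀ hs.ne']
      refine Submodule.smul_mem _ _ (Submodule.subset_span ⟨(hX _).2 ⟨h1.le, fun u hu => ?_⟩, h1⟩)
      rw [inner_smul_right]
      exact mul_nonneg (inv_nonneg.2 hs.le) (((hX x).1 hx).2 u hu)
    obtain ⟨b, hb, hbA⟩ := exists_basis_mem hA
    let k : Fin n := ⟨0, hn⟩
    have hs : supp P l = 1 := le_antisymm (hP.supp_le hl)
      ((hbA k).2.ge.trans (hP.inner_le_supp l (hXP (hbA k).1)))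
    have hsub : {x | x ∈ X ∧ ⟪l, x⟫ = 1} ⊆ face P l := fun x hx => ⟨hXP hx.1, hx.2.trans hs.symm⟩
    refine ⟨⟨hs, (span_eq_top_iff_sdim hn (hsub (hbA k)) fun x hx => hx.2.trans hs).1 ?_⟩, ?_⟩
    · exact eq_top_iff.2 (hA ▸ Submodule.span_mono hsub)
    · obtain ⟨w, hw, -, -, hlw, hXw⟩ := exists_eq_mcut_splx (S := Finset.univ) hXb hX hb
        ⟨k, Finset.mem_univ k⟩ (fun i _ => (hbA i).2)
        (fun x _ i hi => absurd (Finset.mem_univ i) hi)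
      exact ⟨w, hw, fun i => hlw i (Finset.mem_univ i), by rwa [Finset.coe_univ] at hXw⟩
  · left
    obtain ⟨u, hu, hu0⟩ := Submodule.exists_mem_ne_zero_of_ne_bot
      fun h => hspan ((Submodule.orthogonal_eq_bot_iff).1 h)
    refine ⟨u, hu0, fun x hx => ?_⟩
    rw [real_inner_comm]
    exact hu x (Submodule.subset_span hx)

/-- An `SL(n)` contravariant valuation is determined by its values on simplices. -/
theorem IsSLValuation.exists_eq_twoSided (hZ : IsSLValuation Z) (hn : 3 ≤ n) :
    ∃ a b : ℝ, 0 ≤ a ∧ 0 ≤ b ∧ ∀ P, IsPolytope0 P →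
      Z P = convexHull ℝ (twoSided a b (insert 0 (facetPolars P))) := by
  obtain ⟨a, b, ha, hb, hseg⟩ := hZ.exists_splx_eq_segment hn
  refine ⟨a, b, ha, hb, fun P hP => subset_antisymm ?_ ?_⟩
  · have hpos : ∀ z ∈ insert 0 (facetPolars P),
        a • z ∈ convexHull ℝ (twoSided a b (insert 0 (facetPolars P))) := fun z hz =>
      subset_convexHull ℝ _ (Or.inl (Set.smul_mem_smul_set hz))
    have hneg : ∀ z ∈ insert 0 (facetPolars P),
        (-b) • z ∈ convexHull ℝ (twoSided a b (insert 0 (facetPolars P))) := fun z hz => by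
      refine subset_convexHull ℝ _ (Or.inr ?_)
      rw [neg_smul, ← smul_neg]
      exact Set.smul_mem_smul_set (Set.neg_mem_neg.2 hz)
    refine hZ.subset_of_pieces (hZ.cutMono_univ hn) (convex_convexHull ℝ _) hP
      (Set.subset_univ P) fun X l F hX hXP hl hXF => ?_
    rcases orthogonal_or_eq_mcut_splx (by omega) hP.isConvexBody0 hX.isConvexBody0.1.isBounded hXP
      hl hXF with ⟨u, hu, hXu⟩ | ⟨hlP, w, hw, hlw, rfl⟩
    · rw [hZ.eq_zero_of_orthogonal hn hX hu hXu, Set.singleton_subset_iff]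
      simpa using hpos 0 (Set.mem_insert _ _)
    · refine ((hZ.cutMono_univ hn).mcut_subset (isPolytope0_splx w _) (Set.subset_univ _) F).trans
        fun y hy => ?_
      obtain ⟨t, ht, rfl⟩ := (hseg w l hw hlw).2.2 y hy
      rw [← segment_eq_Icc (by linarith)] at ht
      have h := Set.mem_image_of_mem (LinearMap.toSpanSingleton ℝ (Euc n) l) ht
      rw [← LinearMap.coe_toAffineMap, image_segment] at h
      refine (convex_convexHull ℝ _).segment_subset (hneg l (Set.mem_insert_of_mem _ hlP))
        (hpos l (Set.mem_insert_of_mem _ hlP)) ?_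
      simpa using h
  · have h0 := hZ.body P hP
    have hz : ∀ z ∈ insert 0 (facetPolars P), a • z ∈ Z P ∧ (-b) • z ∈ Z P := by
      rintro z (rfl | hz)
      · simpa using h0.2.2
      obtain ⟨w, hw, hwP⟩ := exists_basis_mem_face (by omega) hP.isConvexBody0 hz
      obtain ⟨F, hF⟩ := exists_splx_eq_mcut hP.isConvexBody0
        (fun x hx => (hP.isConvexBody0.inner_le_supp z hx).trans_eq hz.1) hw
        (fun i => (hwP i).1) fun i => (hwP i).2
      have hsub := (hZ.cutMono_univ hn).mcut_subset hP (Set.subset_univ P) F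
      rw [← hF] at hsub
      have h := hseg w z hw fun i => (hwP i).2
      exact ⟨hsub h.1, hsub h.2.1⟩
    refine convexHull_min (Set.union_subset ?_ ?_) h0.2.1
    · rintro _ ⟨z, hzP, rfl⟩
      exact (hz z hzP).1
    · rintro _ ⟨z, hzP, rfl⟩
      have h := (hz _ (Set.mem_neg.1 hzP)).2
      rwa [neg_smul, smul_neg, neg_neg] at h

end

/-- Theorem 1.1: for `n ≥ 3`, a map `Z : P_o^n → K_o^n` is an `SL(n)` contravariant `L_∞`
Minkowski valuation iff `Z P = c₁ Π̂_∞⁺ P +_∞ c₂ Π̂_∞⁻ P` for some constants `c₁, c₂ ≥ 0`,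
where `Π̂_∞⁻ P = -Π̂_∞⁺ P`. -/
theorem sln_contravariant_Linfty_classification (n : ℕ) (hn : 3 ≤ n)
    (Z : Set (Euc n) → Set (Euc n))
    (hbody : ∀ P : Set (Euc n), IsPolytope0 P → IsConvexBody0 (Z P)) :
    (ValuationInf Z ∧ SLContravariant Z) ↔
      ∃ c₁ c₂ : ℝ, 0 ≤ c₁ ∧ 0 ≤ c₂ ∧ ∀ P : Set (Euc n), IsPolytope0 P →
        Z P = convexHull ℝ (c₁ • projBodyInfPlus P ∪ c₂ • (-projBodyInfPlus P)) := by
  have hproj : ∀ (c₁ c₂ : ℝ) (P : Set (Euc n)), IsPolytope0 P →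
      convexHull ℝ (c₁ • projBodyInfPlus P ∪ c₂ • (-projBodyInfPlus P)) =
        convexHull ℝ (twoSided c₁ c₂ (insert 0 (facetPolars P))) := fun c₁ c₂ P hP => by
    rw [projBodyInfPlus_eq hP.isConvexBody0, convexHull_twoSided_convexHull]
  constructor
  · rintro ⟨hval, hcontra⟩
    obtain ⟨a, b, ha, hb, h⟩ := IsSLValuation.exists_eq_twoSided ⟨hbody, hval, hcontra⟩ hn
    exact ⟨a, b, ha, hb, fun P hP => (h P hP).trans (hproj a b P hP).symm⟩
  · rintro ⟨c₁, c₂, -, -, h⟩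
    have h2 : ∀ P, IsPolytope0 P →
        Z P = convexHull ℝ (twoSided c₁ c₂ (insert 0 (facetPolars P))) :=
      fun P hP => (h P hP).trans (hproj c₁ c₂ P hP)
    refine ⟨fun K L hK hL hU hI => ?_, slContravariant_of_eq_twoSided h2⟩
    rw [h2 K hK, h2 L hL, h2 _ hU, h2 _ hI]
    exact convexHull_twoSided_valuation c₁ c₂ (by omega) hK.isConvexBody0 hL.isConvexBody0
      hU.isConvexBody0 hI.isConvexBody0
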